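/- The operator A extends uniquely to a map A : W̄ → W̄: for every f ∈ W̄ and every sequence {fₙ} ⊂ W with ‖f − fₙ‖ → 0, the sequence {Afₙ} is Cauchy in C(D), its limit belongs to W̄ and does not depend on the choice of the approximating sequence. -/

import Mathlib

open Set MeasureTheory Filter Topology

noncomputable section

/-- The context of the BCS-Bogoliubov model: the cutoff `eps`, the Debye energy `om = ℏω_D`,
the potential `U` with bounds `U₁ ≤ U ≤ U₂`, the constant `a`, the temperatures
`tau₁, tau₂, T₀, Tc`, the solutions `Δ₁, Δ₂` of the constant-potential gap equations,
the constant `Mz = max_{z ≥ 0} z / cosh z` and the constant `MT = M_T`. -/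
structure BCSContext where
  eps : ℝ
  om : ℝ
  U : ℝ → ℝ → ℝ
  U₁ : ℝ
  U₂ : ℝ
  Umax : ℝ
  Umin : ℝ
  a : ℝ
  tau₁ : ℝ
  tau₂ : ℝ
  Δ₁ : ℝ → ℝ
  Δ₂ : ℝ → ℝ
  Tc : ℝ
  T₀ : ℝ
  Mz : ℝ
  MT : ℝ
  heps : 0 < eps
  hepsom : eps < om
  hU₁pos : 0 < U₁
  hU₁₂ : U₁ ≤ U₂
  hUsmooth : ContDiffOn ℝ 2 (fun p : ℝ × ℝ => U p.1 p.2) (Icc eps om ×ˢ Icc eps om)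
  hUlb : ∀ x ∈ Icc eps om, ∀ ξ ∈ Icc eps om, U₁ ≤ U x ξ
  hUub : ∀ x ∈ Icc eps om, ∀ ξ ∈ Icc eps om, U x ξ ≤ U₂
  hUmax : IsGreatest (Set.image2 U (Icc eps om) (Icc eps om)) Umax
  hUmin : IsLeast (Set.image2 U (Icc eps om) (Icc eps om)) Umin
  ha : a = (Umax / Umin) ^ 2
  htau₁pos : 0 < tau₁
  htau₂pos : 0 < tau₂
  htau₁ : 1 = U₁ * (∫ ξ in eps..om, Real.tanh (ξ / (2 * tau₁)) / ξ)
  htau₂ : 1 = U₂ * (∫ ξ in eps..om, Real.tanh (ξ / (2 * tau₂)) / ξ)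
  hΔ₁nonneg : ∀ T, 0 ≤ Δ₁ T
  hΔ₂nonneg : ∀ T, 0 ≤ Δ₂ T
  hΔ₁cont : Continuous Δ₁
  hΔ₂cont : Continuous Δ₂
  hΔ₁anti : StrictAntiOn Δ₁ (Icc 0 tau₁)
  hΔ₂anti : StrictAntiOn Δ₂ (Icc 0 tau₂)
  hΔ₁eq : ∀ T ∈ Ioc 0 tau₁, U₁ * (∫ ξ in eps..om,
      Real.tanh (Real.sqrt (ξ ^ 2 + Δ₁ T ^ 2) / (2 * T)) / Real.sqrt (ξ ^ 2 + Δ₁ T ^ 2)) = 1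
  hΔ₂eq : ∀ T ∈ Ioc 0 tau₂, U₂ * (∫ ξ in eps..om,
      Real.tanh (Real.sqrt (ξ ^ 2 + Δ₂ T ^ 2) / (2 * T)) / Real.sqrt (ξ ^ 2 + Δ₂ T ^ 2)) = 1
  hΔ₁zero : ∀ T, tau₁ ≤ T → Δ₁ T = 0
  hΔ₂zero : ∀ T, tau₂ ≤ T → Δ₂ T = 0
  hTc₁ : tau₁ ≤ Tc
  hTc₂ : Tc ≤ tau₂
  hT₀₁ : tau₁ < T₀
  hT₀₂ : T₀ < Tc
  hMz : IsGreatest ((fun z => z / Real.cosh z) '' Set.Ici (0 : ℝ)) Mz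
  hMT : MT = 4 * a * U₂ * Mz ^ 2 /
      (eps * U₁ *
        (Real.tanh (eps / (2 * Tc)) - (eps / (2 * Tc)) / Real.cosh (eps / (2 * Tc)) ^ 2) *
        (∫ ξ in eps..om, (ξ ^ 2 + Δ₂ 0 ^ 2) ^ (-(3 : ℝ) / 2)))

namespace BCSContext

/-- The energy interval `I = [ε, ℏω_D]`. -/
def Iset (C : BCSContext) : Set ℝ := Icc C.eps C.om

/-- The rectangle `D = [T₀, T_c] × I`. -/
def Dset (C : BCSContext) : Set (ℝ × ℝ) := Icc C.T₀ C.Tc ×ˢ Icc C.eps C.om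

end BCSContext

/-- The operator `A` of the squared BCS-Bogoliubov gap equation. -/
def opA (C : BCSContext) (f : ℝ → ℝ → ℝ) (T x : ℝ) : ℝ :=
  (∫ ξ in C.eps..C.om, C.U x ξ * Real.sqrt (f T ξ / (ξ ^ 2 + f T ξ)) *
      Real.tanh (Real.sqrt (ξ ^ 2 + f T ξ) / (2 * T))) ^ 2

/-- Partial derivative with respect to the temperature `T` (within `[T₀, T_c]`). -/
def pderivT (C : BCSContext) (g : ℝ → ℝ → ℝ) (T x : ℝ) : ℝ :=
  derivWithin (fun s => g s x) (Icc C.T₀ C.Tc) T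

/-- Partial derivative with respect to the energy `x` (within `I = [ε, ℏω_D]`). -/
def pderivX (C : BCSContext) (g : ℝ → ℝ → ℝ) (T x : ℝ) : ℝ :=
  derivWithin (fun y => g T y) (Icc C.eps C.om) x

/-- Membership in the set `W`. -/
def memW (C : BCSContext) (f : ℝ → ℝ → ℝ) : Prop :=
  ContDiffOn ℝ 2 (fun p : ℝ × ℝ => f p.1 p.2) C.Dset ∧
  (∀ T ∈ Icc C.T₀ C.Tc, ∀ x ∈ C.Iset, C.Δ₁ T ^ 2 ≤ f T x ∧ f T x ≤ C.Δ₂ T ^ 2) ∧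
  (∀ x ∈ C.Iset, f C.Tc x = 0) ∧
  (∀ T ∈ Ico C.T₀ C.Tc, ∀ x ∈ C.Iset, ∀ x₁ ∈ C.Iset, f T x ≤ C.a * f T x₁) ∧
  (∀ x ∈ C.Iset, ∀ x₁ ∈ C.Iset,
      -(pderivT C f C.Tc x) ≤ C.a * -(pderivT C f C.Tc x₁)) ∧
  (∀ T ∈ Icc C.T₀ C.Tc, ∀ x ∈ C.Iset, pderivT C f T x < 0) ∧
  (∀ T ∈ Icc C.T₀ C.Tc, ∀ x ∈ C.Iset, -(pderivT C f T x) ≤ C.MT)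

/-- The condition `a^{1/4} · max_{(T,x) ∈ D} ∫_I (U(x,ξ)/ξ) tanh(ξ/(2T)) dξ ≤ 1`. -/
def gapCondition (C : BCSContext) : Prop :=
  ∀ T ∈ Icc C.T₀ C.Tc, ∀ x ∈ C.Iset,
    C.a ^ ((1 : ℝ) / 4) * (∫ ξ in C.eps..C.om, C.U x ξ / ξ * Real.tanh (ξ / (2 * T))) ≤ 1

instance (C : BCSContext) : CompactSpace ↥C.Dset :=
  isCompact_iff_compactSpace.mp (isCompact_Icc.prod isCompact_Icc)

-- Extension of a continuous function on `D` to a function on `ℝ × ℝ` (by `0` outside `D`).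
open Classical in
def extFun (C : BCSContext) (F : C(↥C.Dset, ℝ)) : ℝ → ℝ → ℝ :=
  fun T x => if h : (T, x) ∈ C.Dset then F ⟨(T, x), h⟩ else 0

/-- The set `W` regarded as a subset of the Banach space `C(D)`. -/
def WSet (C : BCSContext) : Set C(↥C.Dset, ℝ) :=
  {F | ∃ f : ℝ → ℝ → ℝ, memW C f ∧ ∀ p : ↥C.Dset, F p = f (p : ℝ × ℝ).1 (p : ℝ × ℝ).2}

/-- The value at `u` of the `i`-th Bernstein basis polynomial of degree `n`. -/
def bernsteinWeight (n i : ℕ) (u : ℝ) : ℝ := (bernsteinPolynomial ℝ n i).eval u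

lemma bernsteinWeight_nonneg (n i : ℕ) {u : ℝ} (hu : u ∈ Icc (0 : ℝ) 1) :
    0 ≤ bernsteinWeight n i u := by
  have h : 0 ≤ 1 - u := by linarith [hu.2]
  have h0 := hu.1
  simp only [bernsteinWeight, bernsteinPolynomial, Polynomial.eval_mul, Polynomial.eval_pow,
    Polynomial.eval_natCast, Polynomial.eval_X, Polynomial.eval_sub, Polynomial.eval_one]
  positivity

lemma bernsteinWeight_sum (n : ℕ) (u : ℝ) :
    ∑ i ∈ Finset.range (n + 1), bernsteinWeight n i u = 1 := by
  have := congrArg (Polynomial.eval u) (bernsteinPolynomial.sum ℝ n)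
  simpa [Polynomial.eval_finsetSum, bernsteinWeight] using this

lemma bernsteinWeight_variance {n : ℕ} (hn : n ≠ 0) (u : ℝ) :
    ∑ i ∈ Finset.range (n + 1), ((i : ℝ) / n - u) ^ 2 * bernsteinWeight n i u
      = u * (1 - u) / n := by
  have h := congrArg (Polynomial.eval u) (bernsteinPolynomial.variance ℝ n)
  simp only [Polynomial.eval_finsetSum, Polynomial.eval_mul, Polynomial.eval_pow,
    Polynomial.eval_natCast, Polynomial.eval_X, Polynomial.eval_sub, Polynomial.eval_one,
    nsmul_eq_mul] at h
  have hn' : (n : ℝ) ≠ 0 := by exact_mod_cast hn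
  calc ∑ i ∈ Finset.range (n + 1), ((i : ℝ) / n - u) ^ 2 * bernsteinWeight n i u
      = (∑ i ∈ Finset.range (n + 1), (n * u - i) ^ 2 * bernsteinWeight n i u) / n ^ 2 := by
        rw [Finset.sum_div]
        refine Finset.sum_congr rfl fun i _ => ?_
        field_simp
        ring
    _ = u * (1 - u) / n := by
        simp only [bernsteinWeight]
        rw [h]
        field_simp

lemma hasDerivAt_sum_bernsteinWeight (n : ℕ) (c : ℕ → ℝ) (u : ℝ) :
    HasDerivAt (fun u => ∑ i ∈ Finset.range (n + 2), c i * bernsteinWeight (n + 1) i u)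
      (∑ i ∈ Finset.range (n + 1), (n + 1) * (c (i + 1) - c i) * bernsteinWeight n i u) u := by
  have h : ∀ i, HasDerivAt (fun u => c i * bernsteinWeight (n + 1) i u)
      (c i * (Polynomial.derivative (bernsteinPolynomial ℝ (n + 1) i)).eval u) u := fun i =>
    ((bernsteinPolynomial ℝ (n + 1) i).hasDerivAt u).const_mul _
  have hs := HasDerivAt.fun_sum (u := Finset.range (n + 2)) (fun i _ => h i)
  refine hs.congr_deriv ?_
  rw [Finset.sum_range_succ']
  simp only [bernsteinPolynomial.derivative_succ, bernsteinPolynomial.derivative_zero,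
    Nat.add_sub_cancel, Polynomial.eval_mul, Polynomial.eval_sub, Polynomial.eval_neg,
    Polynomial.eval_natCast, bernsteinWeight]
  set b : ℕ → ℝ := fun i => (bernsteinPolynomial ℝ n i).eval u with hb
  have hlast : b (n + 1) = 0 := by
    simp [hb, bernsteinPolynomial.eq_zero_of_lt ℝ (Nat.lt_succ_self n)]
  have key : ∑ i ∈ Finset.range (n + 1), c (i + 1) * b (i + 1)
      = ∑ i ∈ Finset.range (n + 1), c i * b i - c 0 * b 0 := by
    have h1 := Finset.sum_range_succ (fun i => c i * b i) (n + 1)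
    rw [Finset.sum_range_succ' (fun i => c i * b i) (n + 1), hlast] at h1
    linarith
  change ∑ i ∈ Finset.range (n + 1), c (i + 1) * (((n + 1 : ℕ) : ℝ) * (b i - b (i + 1)))
    + c 0 * (-((n + 1 : ℕ) : ℝ) * b 0) =
      ∑ i ∈ Finset.range (n + 1), (n + 1) * (c (i + 1) - c i) * b i
  have e1 : ∑ i ∈ Finset.range (n + 1), c (i + 1) * (((n + 1 : ℕ) : ℝ) * (b i - b (i + 1)))
      = (n + 1) * (∑ i ∈ Finset.range (n + 1), c (i + 1) * b i
        - ∑ i ∈ Finset.range (n + 1), c (i + 1) * b (i + 1)) := by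
    rw [← Finset.sum_sub_distrib, Finset.mul_sum]
    refine Finset.sum_congr rfl fun i _ => ?_
    push_cast
    ring
  have e2 : ∑ i ∈ Finset.range (n + 1), ((n : ℝ) + 1) * (c (i + 1) - c i) * b i
      = (n + 1) * (∑ i ∈ Finset.range (n + 1), c (i + 1) * b i
        - ∑ i ∈ Finset.range (n + 1), c i * b i) := by
    rw [← Finset.sum_sub_distrib, Finset.mul_sum]
    refine Finset.sum_congr rfl fun i _ => ?_
    ring
  rw [e1, e2, key]
  push_cast
  ring

/-- The tensor-product Bernstein approximation of degree `n` on the unit square. -/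
def bernsteinSq (n : ℕ) (ψ : ℝ → ℝ → ℝ) (u y : ℝ) : ℝ :=
  ∑ i ∈ Finset.range (n + 1),
    (∑ j ∈ Finset.range (n + 1), ψ (i / n) (j / n) * bernsteinWeight n j y) * bernsteinWeight n i u

lemma div_mem_unit {n i : ℕ} (hi : i ∈ Finset.range (n + 1)) : (i : ℝ) / n ∈ Icc (0 : ℝ) 1 := by
  have : (i : ℝ) ≤ n := by exact_mod_cast Nat.lt_succ_iff.1 (Finset.mem_range.1 hi)
  exact ⟨by positivity, div_le_one_of_le₀ this (by positivity)⟩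

lemma bernsteinSq_mono {n : ℕ} {ψ χ : ℝ → ℝ → ℝ} {u y : ℝ} (hu : u ∈ Icc (0 : ℝ) 1)
    (hy : y ∈ Icc (0 : ℝ) 1) (h : ∀ v ∈ Icc (0 : ℝ) 1, ∀ z ∈ Icc (0 : ℝ) 1, ψ v z ≤ χ v z) :
    bernsteinSq n ψ u y ≤ bernsteinSq n χ u y := by
  refine Finset.sum_le_sum fun i hi => ?_
  refine mul_le_mul_of_nonneg_right ?_ (bernsteinWeight_nonneg _ _ hu)
  refine Finset.sum_le_sum fun j hj => ?_
  exact mul_le_mul_of_nonneg_right (h _ (div_mem_unit hi) _ (div_mem_unit hj))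
    (bernsteinWeight_nonneg _ _ hy)

lemma bernsteinSq_quadratic {n : ℕ} (hn : n ≠ 0) (a b c u y : ℝ) :
    bernsteinSq n (fun v z => a + b * (v - u) ^ 2 + c * (z - y) ^ 2) u y
      = a + b * (u * (1 - u) / n) + c * (y * (1 - y) / n) := by
  have h1 : ∀ v : ℝ, ∑ j ∈ Finset.range (n + 1),
      (a + b * (v - u) ^ 2 + c * ((j : ℝ) / n - y) ^ 2) * bernsteinWeight n j y
      = a + b * (v - u) ^ 2 + c * (y * (1 - y) / n) := by
    intro v
    simp only [add_mul _ (c * _)]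
    rw [Finset.sum_add_distrib, ← Finset.mul_sum, bernsteinWeight_sum]
    simp only [mul_assoc c]
    rw [← Finset.mul_sum, bernsteinWeight_variance hn, mul_one]
  simp only [bernsteinSq, h1]
  have h2 : ∀ i : ℕ, (a + b * ((i : ℝ) / n - u) ^ 2 + c * (y * (1 - y) / n)) * bernsteinWeight n i u
      = (a + c * (y * (1 - y) / n)) * bernsteinWeight n i u
        + b * (((i : ℝ) / n - u) ^ 2 * bernsteinWeight n i u) := fun i => by ring
  simp only [h2]
  rw [Finset.sum_add_distrib, ← Finset.mul_sum, ← Finset.mul_sum, bernsteinWeight_sum,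
    bernsteinWeight_variance hn]
  ring

lemma bernsteinSq_neg (n : ℕ) (ψ : ℝ → ℝ → ℝ) (u y : ℝ) :
    bernsteinSq n (fun v z => -ψ v z) u y = -bernsteinSq n ψ u y := by
  simp [bernsteinSq, Finset.sum_neg_distrib]

lemma bernsteinSq_le {n : ℕ} (hn : n ≠ 0) {ψ : ℝ → ℝ → ℝ} {a b u y : ℝ} (hb : 0 ≤ b)
    (hu : u ∈ Icc (0 : ℝ) 1) (hy : y ∈ Icc (0 : ℝ) 1)
    (h : ∀ v ∈ Icc (0 : ℝ) 1, ∀ z ∈ Icc (0 : ℝ) 1,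
      ψ v z ≤ a + b * (v - u) ^ 2 + b * (z - y) ^ 2) :
    bernsteinSq n ψ u y ≤ a + b / n := by
  refine (bernsteinSq_mono hu hy h).trans ?_
  rw [bernsteinSq_quadratic hn]
  have h1 : u * (1 - u) ≤ 1 / 2 := by nlinarith [sq_nonneg (u - 1 / 2)]
  have h2 : y * (1 - y) ≤ 1 / 2 := by nlinarith [sq_nonneg (y - 1 / 2)]
  have : b * (u * (1 - u) / n) + b * (y * (1 - y) / n) = b * (u * (1 - u) + y * (1 - y)) / n := by
    ring
  have h3 : b * (u * (1 - u) + y * (1 - y)) / n ≤ b / n := by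
    gcongr
    nlinarith
  linarith

lemma bernsteinSq_tendsto {ψ : ℝ → ℝ → ℝ}
    (hψ : ContinuousOn (fun p : ℝ × ℝ => ψ p.1 p.2) (Icc 0 1 ×ˢ Icc 0 1)) {ε : ℝ} (hε : 0 < ε) :
    ∀ᶠ n : ℕ in atTop, ∀ u ∈ Icc (0 : ℝ) 1, ∀ y ∈ Icc (0 : ℝ) 1,
      |bernsteinSq n ψ u y - ψ u y| ≤ ε := by
  have hK : IsCompact (Icc (0 : ℝ) 1 ×ˢ Icc (0 : ℝ) 1) := isCompact_Icc.prod isCompact_Icc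
  obtain ⟨B, hB⟩ := hK.exists_bound_of_continuousOn hψ
  have hB0 : 0 ≤ B := (norm_nonneg _).trans (hB (0, 0) (by simp))
  obtain ⟨δ, hδ, hδ'⟩ := Metric.uniformContinuousOn_iff.1
    (hK.uniformContinuousOn_of_continuous hψ) (ε / 2) (half_pos hε)
  set b := 2 * B / δ ^ 2 with hb
  have hb0 : 0 ≤ b := by positivity
  have key : ∀ u ∈ Icc (0 : ℝ) 1, ∀ y ∈ Icc (0 : ℝ) 1, ∀ v ∈ Icc (0 : ℝ) 1, ∀ z ∈ Icc (0 : ℝ) 1,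
      |ψ v z - ψ u y| ≤ ε / 2 + b * (v - u) ^ 2 + b * (z - y) ^ 2 := by
    intro u hu y hy v hv z hz
    by_cases hd : dist (v, z) (u, y) < δ
    · have := (hδ' (v, z) ⟨hv, hz⟩ (u, y) ⟨hu, hy⟩ hd).le
      rw [Real.dist_eq] at this
      have : 0 ≤ b * (v - u) ^ 2 + b * (z - y) ^ 2 := by positivity
      simp only at *
      linarith
    · have h1 : |ψ v z - ψ u y| ≤ 2 * B := by
        have h1 := hB (v, z) ⟨hv, hz⟩
        have h2 := hB (u, y) ⟨hu, hy⟩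
        rw [Real.norm_eq_abs] at h1 h2
        calc |ψ v z - ψ u y| ≤ |ψ v z| + |ψ u y| := abs_sub _ _
          _ ≤ 2 * B := by simp only at h1 h2; linarith
      have h2 : δ ^ 2 ≤ (v - u) ^ 2 + (z - y) ^ 2 := by
        rw [not_lt, Prod.dist_eq, Real.dist_eq, Real.dist_eq, le_max_iff] at hd
        rcases hd with hd | hd
        · have := pow_le_pow_left₀ hδ.le hd 2
          rw [sq_abs] at this
          nlinarith [sq_nonneg (z - y)]
        · have := pow_le_pow_left₀ hδ.le hd 2
          rw [sq_abs] at this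
          nlinarith [sq_nonneg (v - u)]
      have h3 : 2 * B = b * δ ^ 2 := by rw [hb]; field_simp
      nlinarith [mul_le_mul_of_nonneg_left h2 hb0]
  have hlim : Tendsto (fun n : ℕ => b / (n : ℝ)) atTop (𝓝 0) :=
    tendsto_const_div_atTop_nhds_zero_nat b
  filter_upwards [hlim.eventually_le_const (half_pos hε), eventually_ne_atTop 0]
    with n hn hn0 u hu y hy
  have h1 : bernsteinSq n ψ u y ≤ (ψ u y + ε / 2) + b / n :=
    bernsteinSq_le hn0 hb0 hu hy fun v hv z hz => by
      have := (abs_le.1 (key u hu y hy v hv z hz)).2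
      linarith
  have h2 : bernsteinSq n (fun v z => -ψ v z) u y ≤ (-ψ u y + ε / 2) + b / n :=
    bernsteinSq_le hn0 hb0 hu hy fun v hv z hz => by
      have := (abs_le.1 (key u hu y hy v hv z hz)).1
      linarith
  rw [bernsteinSq_neg] at h2
  rw [abs_le]
  constructor <;> linarith

lemma bernsteinWeight_zero (n i : ℕ) : bernsteinWeight n i 0 = if i = 0 then 1 else 0 :=
  bernsteinPolynomial.eval_at_0 ℝ n i

lemma sum_bernsteinWeight_le {n : ℕ} {c : ℕ → ℝ} {A u : ℝ} (hu : u ∈ Icc (0 : ℝ) 1)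
    (h : ∀ i ∈ Finset.range (n + 1), c i ≤ A) :
    ∑ i ∈ Finset.range (n + 1), c i * bernsteinWeight n i u ≤ A := by
  calc ∑ i ∈ Finset.range (n + 1), c i * bernsteinWeight n i u
      ≤ ∑ i ∈ Finset.range (n + 1), A * bernsteinWeight n i u :=
        Finset.sum_le_sum fun i hi =>
          mul_le_mul_of_nonneg_right (h i hi) (bernsteinWeight_nonneg _ _ hu)
    _ = A := by rw [← Finset.mul_sum, bernsteinWeight_sum, mul_one]

lemma le_sum_bernsteinWeight {n : ℕ} {c : ℕ → ℝ} {A u : ℝ} (hu : u ∈ Icc (0 : ℝ) 1)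
    (h : ∀ i ∈ Finset.range (n + 1), A ≤ c i) :
    A ≤ ∑ i ∈ Finset.range (n + 1), c i * bernsteinWeight n i u := by
  have := sum_bernsteinWeight_le (c := fun i => -c i) (A := -A) hu fun i hi => neg_le_neg (h i hi)
  simp only [neg_mul, Finset.sum_neg_distrib] at this
  linarith

lemma sum_bernsteinWeight_ratio {n : ℕ} {c : ℕ → ℝ} {a y y' : ℝ} (hy : y ∈ Icc (0 : ℝ) 1)
    (hy' : y' ∈ Icc (0 : ℝ) 1)
    (h : ∀ i ∈ Finset.range (n + 1), ∀ j ∈ Finset.range (n + 1), c i ≤ a * c j) :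
    ∑ i ∈ Finset.range (n + 1), c i * bernsteinWeight n i y
      ≤ a * ∑ i ∈ Finset.range (n + 1), c i * bernsteinWeight n i y' := by
  refine sum_bernsteinWeight_le hy fun i hi => ?_
  rw [Finset.mul_sum]
  simp only [← mul_assoc]
  exact le_sum_bernsteinWeight (c := fun j => a * c j) hy' fun j hj => h i hi j hj

lemma bernsteinSq_ratio {n : ℕ} {ψ : ℝ → ℝ → ℝ} {a u y y' : ℝ} (hu : u ∈ Icc (0 : ℝ) 1)
    (hy : y ∈ Icc (0 : ℝ) 1) (hy' : y' ∈ Icc (0 : ℝ) 1)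
    (h : ∀ v ∈ Icc (0 : ℝ) 1, ∀ z ∈ Icc (0 : ℝ) 1, ∀ z' ∈ Icc (0 : ℝ) 1, ψ v z ≤ a * ψ v z') :
    bernsteinSq n ψ u y ≤ a * bernsteinSq n ψ u y' := by
  rw [bernsteinSq, bernsteinSq, Finset.mul_sum]
  refine Finset.sum_le_sum fun i hi => ?_
  rw [← mul_assoc]
  refine mul_le_mul_of_nonneg_right ?_ (bernsteinWeight_nonneg _ _ hu)
  exact sum_bernsteinWeight_ratio hy hy' fun j hj k hk =>
    h _ (div_mem_unit hi) _ (div_mem_unit hj) _ (div_mem_unit hk)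

lemma bernsteinSq_nonneg {n : ℕ} {ψ : ℝ → ℝ → ℝ} {u y : ℝ} (hu : u ∈ Icc (0 : ℝ) 1)
    (hy : y ∈ Icc (0 : ℝ) 1) (h : ∀ v ∈ Icc (0 : ℝ) 1, ∀ z ∈ Icc (0 : ℝ) 1, 0 ≤ ψ v z) :
    0 ≤ bernsteinSq n ψ u y :=
  le_sum_bernsteinWeight hu fun _ hi =>
    le_sum_bernsteinWeight hy fun _ hj => h _ (div_mem_unit hi) _ (div_mem_unit hj)

lemma bernsteinSq_zero_left {n : ℕ} {ψ : ℝ → ℝ → ℝ} {y : ℝ}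
    (h : ∀ z ∈ Icc (0 : ℝ) 1, ψ 0 z = 0) : bernsteinSq n ψ 0 y = 0 := by
  refine Finset.sum_eq_zero fun i hi => ?_
  rw [bernsteinWeight_zero]
  split_ifs with h0
  · subst h0
    rw [mul_one]
    refine Finset.sum_eq_zero fun j hj => ?_
    rw [Nat.cast_zero, zero_div, h _ (div_mem_unit hj), zero_mul]
  · rw [mul_zero]

lemma contDiff_bernsteinWeight (n i : ℕ) {m : WithTop ℕ∞} : ContDiff ℝ m (bernsteinWeight n i) := by
  have h := (bernsteinPolynomial ℝ n i).contDiff_aeval (𝕜 := ℝ) (R := ℝ) m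
  simp only [Polynomial.coe_aeval_eq_eval] at h
  exact h

lemma contDiff_bernsteinSq (n : ℕ) (ψ : ℝ → ℝ → ℝ) {m : WithTop ℕ∞} :
    ContDiff ℝ m (fun p : ℝ × ℝ => bernsteinSq n ψ p.1 p.2) := by
  unfold bernsteinSq
  refine ContDiff.sum fun i _ => ContDiff.mul (ContDiff.sum fun j _ => ?_) ?_
  · exact contDiff_const.mul ((contDiff_bernsteinWeight _ _).comp contDiff_snd)
  · exact (contDiff_bernsteinWeight _ _).comp contDiff_fst

/-- The first partial derivative of `bernsteinSq (n + 1) ψ`. -/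
def bernsteinSqDeriv (n : ℕ) (ψ : ℝ → ℝ → ℝ) (u y : ℝ) : ℝ :=
  ∑ i ∈ Finset.range (n + 1), (n + 1) *
    (∑ j ∈ Finset.range (n + 2),
        ψ ((i + 1 : ℕ) / (n + 1 : ℕ)) (j / (n + 1 : ℕ)) * bernsteinWeight (n + 1) j y
      - ∑ j ∈ Finset.range (n + 2), ψ (i / (n + 1 : ℕ)) (j / (n + 1 : ℕ)) *
        bernsteinWeight (n + 1) j y) * bernsteinWeight n i u

lemma hasDerivAt_bernsteinSq (n : ℕ) (ψ : ℝ → ℝ → ℝ) (u y : ℝ) :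
    HasDerivAt (fun u => bernsteinSq (n + 1) ψ u y) (bernsteinSqDeriv n ψ u y) u :=
  hasDerivAt_sum_bernsteinWeight n (fun i => ∑ j ∈ Finset.range (n + 2),
    ψ (i / (n + 1 : ℕ)) (j / (n + 1 : ℕ)) * bernsteinWeight (n + 1) j y) u

lemma bernsteinSqDeriv_nonneg {n : ℕ} {ψ : ℝ → ℝ → ℝ} {u y : ℝ} (hu : u ∈ Icc (0 : ℝ) 1)
    (hy : y ∈ Icc (0 : ℝ) 1)
    (h : ∀ v ∈ Icc (0 : ℝ) 1, ∀ v' ∈ Icc (0 : ℝ) 1, ∀ z ∈ Icc (0 : ℝ) 1, v ≤ v' → ψ v z ≤ ψ v' z) :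
    0 ≤ bernsteinSqDeriv n ψ u y := by
  refine le_sum_bernsteinWeight hu fun i hi => mul_nonneg (by positivity) (sub_nonneg.2 ?_)
  refine Finset.sum_le_sum fun j hj => ?_
  have hi' := Finset.mem_range.1 hi
  refine mul_le_mul_of_nonneg_right (h _ (div_mem_unit ?_) _ (div_mem_unit ?_) _ (div_mem_unit hj)
    ?_)
    (bernsteinWeight_nonneg _ _ hy)
  · exact Finset.mem_range.2 (by omega)
  · exact Finset.mem_range.2 (by omega)
  · gcongr
    omega

lemma bernsteinSqDeriv_le {n : ℕ} {ψ : ℝ → ℝ → ℝ} {u y K : ℝ} (hu : u ∈ Icc (0 : ℝ) 1)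
    (hy : y ∈ Icc (0 : ℝ) 1)
    (h : ∀ v ∈ Icc (0 : ℝ) 1, ∀ v' ∈ Icc (0 : ℝ) 1, ∀ z ∈ Icc (0 : ℝ) 1, v ≤ v' →
      ψ v' z - ψ v z ≤ K * (v' - v)) :
    bernsteinSqDeriv n ψ u y ≤ K := by
  refine sum_bernsteinWeight_le hu fun i hi => ?_
  have hi' := Finset.mem_range.1 hi
  rw [← Finset.sum_sub_distrib]
  simp only [← sub_mul]
  have hn : (0 : ℝ) < n + 1 := by positivity
  have : ∑ j ∈ Finset.range (n + 2), (ψ ((i + 1 : ℕ) / (n + 1 : ℕ)) (j / (n + 1 : ℕ))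
      - ψ (i / (n + 1 : ℕ)) (j / (n + 1 : ℕ))) * bernsteinWeight (n + 1) j y ≤ K / (n + 1) := by
    refine sum_bernsteinWeight_le hy fun j hj => ?_
    refine (h _ (div_mem_unit ?_) _ (div_mem_unit ?_) _ (div_mem_unit hj)
    ?_).trans_eq ?_
    · exact Finset.mem_range.2 (by omega)
    · exact Finset.mem_range.2 (by omega)
    · gcongr
      omega
    · push_cast
      field_simp
      ring
  calc _ ≤ (n + 1 : ℝ) * (K / (n + 1)) := mul_le_mul_of_nonneg_left this hn.le
    _ = K := by field_simp

lemma bernsteinSqDeriv_zero_ratio {n : ℕ} {ψ : ℝ → ℝ → ℝ} {a y y' : ℝ}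
    (hy : y ∈ Icc (0 : ℝ) 1) (hy' : y' ∈ Icc (0 : ℝ) 1) (h0 : ∀ z ∈ Icc (0 : ℝ) 1, ψ 0 z = 0)
    (h : ∀ v ∈ Icc (0 : ℝ) 1, ∀ z ∈ Icc (0 : ℝ) 1, ∀ z' ∈ Icc (0 : ℝ) 1, ψ v z ≤ a * ψ v z') :
    bernsteinSqDeriv n ψ 0 y ≤ a * bernsteinSqDeriv n ψ 0 y' := by
  have key : ∀ y, bernsteinSqDeriv n ψ 0 y = (n + 1) * ∑ j ∈ Finset.range (n + 2),
      ψ ((1 : ℕ) / (n + 1 : ℕ)) (j / (n + 1 : ℕ)) * bernsteinWeight (n + 1) j y := by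
    intro y
    have hz : ∑ j ∈ Finset.range (n + 2), ψ ((0 : ℕ) / (n + 1 : ℕ)) (j / (n + 1 : ℕ)) *
        bernsteinWeight (n + 1) j y = 0 := Finset.sum_eq_zero fun j hj => by
      rw [Nat.cast_zero, zero_div, h0 _ (div_mem_unit hj), zero_mul]
    rw [bernsteinSqDeriv, Finset.sum_eq_single_of_mem 0 (by simp)]
    · rw [bernsteinWeight_zero, if_pos rfl, hz, mul_one, sub_zero]
    · intro i _ hi
      rw [bernsteinWeight_zero, if_neg hi, mul_zero]
  rw [key, key, mul_left_comm]
  refine mul_le_mul_of_nonneg_left ?_ (by positivity)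
  refine sum_bernsteinWeight_ratio hy hy' fun j hj k hk => ?_
  exact h _ (div_mem_unit (Finset.mem_range.2 (by omega))) _ (div_mem_unit hj) _ (div_mem_unit hk)

namespace BCSContext

variable (C : BCSContext)

lemma T₀_pos : 0 < C.T₀ := C.htau₁pos.trans C.hT₀₁

lemma Δ₁_eq_zero {T : ℝ} (hT : T ∈ Icc C.T₀ C.Tc) : C.Δ₁ T = 0 :=
  C.hΔ₁zero T (C.hT₀₁.le.trans hT.1)

lemma Umin_pos : 0 < C.Umin := by
  obtain ⟨x, hx, ξ, hξ, h⟩ := C.hUmin.1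
  exact h ▸ C.hU₁pos.trans_le (C.hUlb x hx ξ hξ)

lemma Umin_le_Umax : C.Umin ≤ C.Umax := C.hUmin.2 C.hUmax.1

lemma one_le_a : 1 ≤ C.a := by
  rw [C.ha]
  exact one_le_pow₀ ((one_le_div C.Umin_pos).2 C.Umin_le_Umax)

end BCSContext

lemma extFun_apply (C : BCSContext) (F : C(↥C.Dset, ℝ)) {T x : ℝ} (h : (T, x) ∈ C.Dset) :
    extFun C F T x = F ⟨(T, x), h⟩ := dif_pos h

lemma continuousOn_extFun (C : BCSContext) (F : C(↥C.Dset, ℝ)) :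
    ContinuousOn (fun p : ℝ × ℝ => extFun C F p.1 p.2) C.Dset := by
  rw [continuousOn_iff_continuous_domRestrict]
  refine F.continuous.congr fun p => ?_
  exact (extFun_apply C F p.2).symm

/-- The order, Lipschitz and ratio constraints characterising the closure of `W`. -/
structure ClosedConstraints (C : BCSContext) (φ : ℝ → ℝ → ℝ) : Prop where
  nonneg : ∀ T ∈ Icc C.T₀ C.Tc, ∀ x ∈ C.Iset, 0 ≤ φ T x
  le_sq : ∀ T ∈ Icc C.T₀ C.Tc, ∀ x ∈ C.Iset, φ T x ≤ C.Δ₂ T ^ 2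
  zero : ∀ x ∈ C.Iset, φ C.Tc x = 0
  ratio : ∀ T ∈ Icc C.T₀ C.Tc, ∀ x ∈ C.Iset, ∀ x₁ ∈ C.Iset, φ T x ≤ C.a * φ T x₁
  anti : ∀ x ∈ C.Iset, AntitoneOn (fun T => φ T x) (Icc C.T₀ C.Tc)
  lip : ∀ x ∈ C.Iset, ∀ T ∈ Icc C.T₀ C.Tc, ∀ T' ∈ Icc C.T₀ C.Tc, T ≤ T' →
    φ T x - φ T' x ≤ C.MT * (T' - T)

/-- `φ` transported to the unit square, with temperature reversed and delayed by `δ`. -/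
def delayed (C : BCSContext) (φ : ℝ → ℝ → ℝ) (δ u y : ℝ) : ℝ :=
  φ (C.Tc - max ((C.Tc - C.T₀) * u - δ) 0) (C.eps + (C.om - C.eps) * y)

section Delayed

variable {C : BCSContext} {φ : ℝ → ℝ → ℝ} {δ : ℝ}

lemma delayed_time_mem (hδ : 0 ≤ δ) {u : ℝ} (hu : u ∈ Icc (0 : ℝ) 1) :
    C.Tc - max ((C.Tc - C.T₀) * u - δ) 0 ∈ Icc C.T₀ C.Tc := by
  have hL := sub_pos.2 C.hT₀₂
  have h1 : (C.Tc - C.T₀) * u ≤ C.Tc - C.T₀ := mul_le_of_le_one_right hL.le hu.2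
  constructor
  · have : max ((C.Tc - C.T₀) * u - δ) 0 ≤ C.Tc - C.T₀ := max_le (by linarith) hL.le
    linarith
  · have := le_max_right ((C.Tc - C.T₀) * u - δ) 0
    linarith

lemma delayed_energy_mem {y : ℝ} (hy : y ∈ Icc (0 : ℝ) 1) :
    C.eps + (C.om - C.eps) * y ∈ C.Iset := by
  have hL := sub_pos.2 C.hepsom
  have h1 : (C.om - C.eps) * y ≤ C.om - C.eps := mul_le_of_le_one_right hL.le hy.2
  have h2 : 0 ≤ (C.om - C.eps) * y := mul_nonneg hL.le hy.1
  exact ⟨by linarith, by linarith⟩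

lemma delayed_continuousOn (hδ : 0 ≤ δ)
    (hφ : ContinuousOn (fun p : ℝ × ℝ => φ p.1 p.2) C.Dset) :
    ContinuousOn (fun p : ℝ × ℝ => delayed C φ δ p.1 p.2) (Icc 0 1 ×ˢ Icc 0 1) :=
  hφ.comp (f := fun p : ℝ × ℝ => (C.Tc - max ((C.Tc - C.T₀) * p.1 - δ) 0,
    C.eps + (C.om - C.eps) * p.2)) (by fun_prop)
    fun _ hp => ⟨delayed_time_mem hδ hp.1, delayed_energy_mem hp.2⟩

lemma delayed_of_le {u : ℝ} (hu : (C.Tc - C.T₀) * u ≤ δ) (hφ : ClosedConstraints C φ) {y : ℝ}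
    (hy : y ∈ Icc (0 : ℝ) 1) : delayed C φ δ u y = 0 := by
  rw [delayed, max_eq_right (by linarith), sub_zero]
  exact hφ.zero _ (delayed_energy_mem hy)

lemma delayed_nonneg (hδ : 0 ≤ δ) (hφ : ClosedConstraints C φ) {u y : ℝ}
    (hu : u ∈ Icc (0 : ℝ) 1) (hy : y ∈ Icc (0 : ℝ) 1) : 0 ≤ delayed C φ δ u y :=
  hφ.nonneg _ (delayed_time_mem hδ hu) _ (delayed_energy_mem hy)

lemma delayed_ratio (hδ : 0 ≤ δ) (hφ : ClosedConstraints C φ) {u y y' : ℝ}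
    (hu : u ∈ Icc (0 : ℝ) 1) (hy : y ∈ Icc (0 : ℝ) 1) (hy' : y' ∈ Icc (0 : ℝ) 1) :
    delayed C φ δ u y ≤ C.a * delayed C φ δ u y' :=
  hφ.ratio _ (delayed_time_mem hδ hu) _ (delayed_energy_mem hy) _ (delayed_energy_mem hy')

lemma delayed_mono (hδ : 0 ≤ δ) (hφ : ClosedConstraints C φ) {u u' y : ℝ}
    (hu : u ∈ Icc (0 : ℝ) 1) (hu' : u' ∈ Icc (0 : ℝ) 1) (hy : y ∈ Icc (0 : ℝ) 1) (h : u ≤ u') :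
    delayed C φ δ u y ≤ delayed C φ δ u' y := by
  have hL := sub_pos.2 C.hT₀₂
  refine hφ.anti _ (delayed_energy_mem hy) (delayed_time_mem hδ hu') (delayed_time_mem hδ hu) ?_
  gcongr

lemma MT_nonneg_of_closedConstraints (hφ : ClosedConstraints C φ) : 0 ≤ C.MT := by
  have hx : C.eps ∈ C.Iset := ⟨le_rfl, C.hepsom.le⟩
  have h0 : C.T₀ ∈ Icc C.T₀ C.Tc := ⟨le_rfl, C.hT₀₂.le⟩
  have h1 : C.Tc ∈ Icc C.T₀ C.Tc := ⟨C.hT₀₂.le, le_rfl⟩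
  have h2 := hφ.lip _ hx _ h0 _ h1 C.hT₀₂.le
  have h3 := hφ.anti _ hx h0 h1 C.hT₀₂.le
  simp only at h3
  by_contra! h
  nlinarith [mul_neg_of_neg_of_pos h (sub_pos.2 C.hT₀₂)]

lemma delayed_lip (hδ : 0 ≤ δ) (hφ : ClosedConstraints C φ) {u u' y : ℝ}
    (hu : u ∈ Icc (0 : ℝ) 1) (hu' : u' ∈ Icc (0 : ℝ) 1) (hy : y ∈ Icc (0 : ℝ) 1) (h : u ≤ u') :
    delayed C φ δ u' y - delayed C φ δ u y ≤ C.MT * (C.Tc - C.T₀) * (u' - u) := by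
  have hL := sub_pos.2 C.hT₀₂
  refine (hφ.lip _ (delayed_energy_mem hy) _ (delayed_time_mem hδ hu') _
    (delayed_time_mem hδ hu) (by gcongr)).trans ?_
  rw [mul_assoc]
  refine mul_le_mul_of_nonneg_left ?_ (MT_nonneg_of_closedConstraints hφ)
  have h1 : (C.Tc - C.T₀) * u ≤ (C.Tc - C.T₀) * u' := by gcongr
  have h2 : max ((C.Tc - C.T₀) * u' - δ) 0 ≤
      max ((C.Tc - C.T₀) * u - δ) 0 + ((C.Tc - C.T₀) * u' - (C.Tc - C.T₀) * u) := by
    refine max_le ?_ ?_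
    · linarith [le_max_left ((C.Tc - C.T₀) * u - δ) 0]
    · linarith [le_max_right ((C.Tc - C.T₀) * u - δ) 0]
  linarith

lemma delayed_le (hδ : 0 ≤ δ) (hφ : ClosedConstraints C φ) {u y : ℝ}
    (hu : u ∈ Icc (0 : ℝ) 1) (hy : y ∈ Icc (0 : ℝ) 1) :
    delayed C φ δ u y ≤ φ (C.Tc - (C.Tc - C.T₀) * u) (C.eps + (C.om - C.eps) * y) := by
  have hL := sub_pos.2 C.hT₀₂
  have h0 := mul_nonneg hL.le hu.1
  have h1 : (C.Tc - C.T₀) * u ≤ C.Tc - C.T₀ := mul_le_of_le_one_right hL.le hu.2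
  refine hφ.anti _ (delayed_energy_mem hy) ⟨by linarith, by linarith⟩ (delayed_time_mem hδ hu) ?_
  have : max ((C.Tc - C.T₀) * u - δ) 0 ≤ (C.Tc - C.T₀) * u := max_le (by linarith) h0
  linarith

lemma le_delayed_add (hδ : 0 ≤ δ) (hφ : ClosedConstraints C φ) {u y : ℝ}
    (hu : u ∈ Icc (0 : ℝ) 1) (hy : y ∈ Icc (0 : ℝ) 1) :
    φ (C.Tc - (C.Tc - C.T₀) * u) (C.eps + (C.om - C.eps) * y) ≤
      delayed C φ δ u y + C.MT * δ := by
  have hL := sub_pos.2 C.hT₀₂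
  have h0 := mul_nonneg hL.le hu.1
  have h1 : (C.Tc - C.T₀) * u ≤ C.Tc - C.T₀ := mul_le_of_le_one_right hL.le hu.2
  have h2 : max ((C.Tc - C.T₀) * u - δ) 0 ≤ (C.Tc - C.T₀) * u := max_le (by linarith) h0
  have h3 := hφ.lip _ (delayed_energy_mem hy) (C.Tc - (C.Tc - C.T₀) * u)
    ⟨by linarith, by linarith⟩ _ (delayed_time_mem hδ hu) (by linarith)
  have h4 : C.MT * (C.Tc - max ((C.Tc - C.T₀) * u - δ) 0 - (C.Tc - (C.Tc - C.T₀) * u))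
      ≤ C.MT * δ := by
    refine mul_le_mul_of_nonneg_left ?_ (MT_nonneg_of_closedConstraints hφ)
    linarith [le_max_left ((C.Tc - C.T₀) * u - δ) 0]
  rw [delayed]
  linarith

/-- Far from the transition temperature the delay leaves room; near it the delayed function
vanishes and its Bernstein approximation is `o(u)`. -/
lemma bernsteinSq_delayed_le (hδ : 0 < δ) (hφ : ClosedConstraints C φ) {c : ℝ} (hc : 0 < c) :
    ∀ᶠ n : ℕ in atTop, ∀ u ∈ Icc (0 : ℝ) 1, ∀ y ∈ Icc (0 : ℝ) 1,
      (C.Tc - C.T₀) * u ≤ δ / 2 → bernsteinSq n (delayed C φ δ) u y ≤ c * u := by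
  have hL := sub_pos.2 C.hT₀₂
  have hM := MT_nonneg_of_closedConstraints hφ
  set L := C.Tc - C.T₀ with hLdef
  set B := C.MT * L * (4 * L ^ 2 / δ ^ 2) with hB
  have hB0 : 0 ≤ B := by positivity
  have hlim : Tendsto (fun n : ℕ => B / (n : ℝ)) atTop (𝓝 0) :=
    tendsto_const_div_atTop_nhds_zero_nat B
  filter_upwards [hlim.eventually_le_const hc, eventually_ne_atTop 0]
    with n hn hn0 u hu y hy hus
  have h1 : bernsteinSq n (delayed C φ δ) u y ≤
      bernsteinSq n (fun v z => 0 + B * (v - u) ^ 2 + 0 * (z - y) ^ 2) u y := by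
    refine bernsteinSq_mono hu hy fun v hv z hz => ?_
    rw [zero_add, zero_mul, add_zero]
    by_cases hvs : L * v ≤ δ
    · rw [delayed_of_le hvs hφ hz]
      positivity
    · push Not at hvs
      have h2 := delayed_lip hδ.le hφ (unitInterval.zero_mem) hv hz hv.1
      rw [delayed_of_le (u := 0) (by rw [mul_zero]; exact hδ.le) hφ hz, sub_zero,
        sub_zero, ← hLdef] at h2
      have h3 : C.MT * L * v ≤ C.MT * L * 1 := mul_le_mul_of_nonneg_left hv.2 (by positivity)
      have h4 : 1 ≤ 4 * L ^ 2 / δ ^ 2 * (v - u) ^ 2 := by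
        rw [div_mul_eq_mul_div, one_le_div (by positivity)]
        have : δ ≤ 2 * (L * (v - u)) := by linarith
        nlinarith
      calc delayed C φ δ v z ≤ C.MT * L * 1 := h2.trans h3
        _ ≤ C.MT * L * (4 * L ^ 2 / δ ^ 2 * (v - u) ^ 2) :=
          mul_le_mul_of_nonneg_left h4 (by positivity)
        _ = B * (v - u) ^ 2 := by rw [hB]; ring
  refine h1.trans ?_
  rw [bernsteinSq_quadratic hn0, zero_add, zero_mul, add_zero]
  have h5 : u * (1 - u) ≤ u := by nlinarith [sq_nonneg u]
  calc B * (u * (1 - u) / n) = B / n * (u * (1 - u)) := by ring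
    _ ≤ c * u := mul_le_mul hn h5 (mul_nonneg hu.1 (by linarith [hu.2])) hc.le

end Delayed

/-- A polynomial approximation of `φ` that lies in `W` for suitable parameters. -/
def approximant (C : BCSContext) (φ : ℝ → ℝ → ℝ) (c κ δ : ℝ) (n : ℕ) (T x : ℝ) : ℝ :=
  (1 - κ) * bernsteinSq (n + 1) (delayed C φ δ) ((C.Tc - T) / (C.Tc - C.T₀))
    ((x - C.eps) / (C.om - C.eps)) + κ * c * (C.Tc - T)

section Approximant

variable {C : BCSContext} {φ : ℝ → ℝ → ℝ} {c κ δ : ℝ}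

lemma reversed_time_mem {T : ℝ} (hT : T ∈ Icc C.T₀ C.Tc) :
    (C.Tc - T) / (C.Tc - C.T₀) ∈ Icc (0 : ℝ) 1 := by
  have hL := sub_pos.2 C.hT₀₂
  exact ⟨div_nonneg (by linarith [hT.2]) hL.le, (div_le_one hL).2 (by linarith [hT.1])⟩

lemma rescaled_energy_mem {x : ℝ} (hx : x ∈ C.Iset) :
    (x - C.eps) / (C.om - C.eps) ∈ Icc (0 : ℝ) 1 := by
  have hL := sub_pos.2 C.hepsom
  exact ⟨div_nonneg (by linarith [hx.1]) hL.le, (div_le_one hL).2 (by linarith [hx.2])⟩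

lemma hasDerivAt_approximant (n : ℕ) (T x : ℝ) :
    HasDerivAt (fun T => approximant C φ c κ δ n T x)
      (-((1 - κ) * (bernsteinSqDeriv n (delayed C φ δ) ((C.Tc - T) / (C.Tc - C.T₀))
        ((x - C.eps) / (C.om - C.eps)) / (C.Tc - C.T₀)) + κ * c)) T := by
  have h1 : HasDerivAt (fun T : ℝ => C.Tc - T) (-1) T := by
    simpa using (hasDerivAt_id T).const_sub C.Tc
  have h2 := h1.div_const (C.Tc - C.T₀)
  have h3 := (hasDerivAt_bernsteinSq n (delayed C φ δ) ((C.Tc - T) / (C.Tc - C.T₀))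
    ((x - C.eps) / (C.om - C.eps))).comp T h2
  have h4 := (h3.const_mul (1 - κ)).add (h1.const_mul (κ * c))
  exact h4.congr_deriv (by ring)

lemma pderivT_approximant (n : ℕ) {T : ℝ} (hT : T ∈ Icc C.T₀ C.Tc) (x : ℝ) :
    pderivT C (approximant C φ c κ δ n) T x =
      -((1 - κ) * (bernsteinSqDeriv n (delayed C φ δ) ((C.Tc - T) / (C.Tc - C.T₀))
        ((x - C.eps) / (C.om - C.eps)) / (C.Tc - C.T₀)) + κ * c) :=
  (hasDerivAt_approximant n T x).hasDerivWithinAt.derivWithin (uniqueDiffOn_Icc C.hT₀₂ T hT)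

lemma memW_approximant (hφ : ClosedConstraints C φ)
    (hcont : ContinuousOn (fun p : ℝ × ℝ => φ p.1 p.2) C.Dset) (hδ : 0 < δ) (hκ : 0 < κ)
    (hκ1 : κ < 1) (hc : 0 < c) (hcM : c ≤ C.MT)
    (hΔ : ∀ T ∈ Icc C.T₀ C.Tc, 2 * c * (C.Tc - T) ≤ C.Δ₂ T ^ 2) :
    ∀ᶠ n : ℕ in atTop, memW C (approximant C φ c κ δ n) := by
  have hL := sub_pos.2 C.hT₀₂
  have hκ1' := sub_pos.2 hκ1
  have ha := C.one_le_a
  have ev1 := (tendsto_add_atTop_nat 1).eventually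
    (bernsteinSq_delayed_le hδ hφ (mul_pos hc hL))
  have ev2 := (tendsto_add_atTop_nat 1).eventually
    (bernsteinSq_tendsto (delayed_continuousOn hδ.le hcont)
      (show 0 < κ * c * (δ / 2) by positivity))
  filter_upwards [ev1, ev2] with n hn1 hn2
  have hδ0 : ∀ z ∈ Icc (0 : ℝ) 1, delayed C φ δ 0 z = 0 := fun z hz =>
    delayed_of_le (u := 0) (by rw [mul_zero]; exact hδ.le) hφ hz
  have hTc : (C.Tc - C.Tc) / (C.Tc - C.T₀) = 0 := by rw [sub_self, zero_div]
  refine ⟨?_, ?_, ?_, ?_, ?_, ?_, ?_⟩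
  · refine ContDiff.contDiffOn ?_
    unfold approximant
    refine (contDiff_const.mul ?_).add (by fun_prop)
    exact (contDiff_bernsteinSq (n + 1) (delayed C φ δ)).comp
      (f := fun p : ℝ × ℝ => ((C.Tc - p.1) / (C.Tc - C.T₀), (p.2 - C.eps) / (C.om - C.eps)))
      (by fun_prop)
  · intro T hT x hx
    have hu := reversed_time_mem hT
    have hy := rescaled_energy_mem hx
    have hs : 0 ≤ C.Tc - T := sub_nonneg.2 hT.2
    have hLu : (C.Tc - C.T₀) * ((C.Tc - T) / (C.Tc - C.T₀)) = C.Tc - T := by field_simp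
    have hly : C.eps + (C.om - C.eps) * ((x - C.eps) / (C.om - C.eps)) = x := by
      have := (sub_pos.2 C.hepsom).ne'
      field_simp
      ring
    constructor
    · rw [C.Δ₁_eq_zero hT, approximant]
      have := bernsteinSq_nonneg (n := n + 1) hu hy fun v hv z hz =>
        delayed_nonneg hδ.le hφ hv hz
      rw [zero_pow two_ne_zero]
      positivity
    · have hΔT := hΔ T hT
      rw [approximant]
      set u := (C.Tc - T) / (C.Tc - C.T₀) with hudef
      set y := (x - C.eps) / (C.om - C.eps) with hydef
      by_cases hsmall : C.Tc - T ≤ δ / 2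
      · have h1 := hn1 u hu y hy (by rw [hLu]; exact hsmall)
        rw [mul_assoc, hLu] at h1
        have h2 := mul_le_mul_of_nonneg_left h1 hκ1'.le
        have h3 : 0 ≤ c * (C.Tc - T) := by positivity
        linarith
      · push Not at hsmall
        have h1 := (abs_le.1 (hn2 u hu y hy)).2
        have h2 := delayed_le hδ.le hφ hu hy
        rw [hLu, hly, sub_sub_cancel] at h2
        have h3 := hφ.le_sq T hT x hx
        have h4 : κ * c * (δ / 2) ≤ κ * c * (C.Tc - T) := by gcongr
        have h5 : bernsteinSq (n + 1) (delayed C φ δ) u y ≤ C.Δ₂ T ^ 2 + κ * c * (C.Tc - T) := by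
          linarith
        have h6 := mul_le_mul_of_nonneg_left h5 hκ1'.le
        have h7 := mul_le_mul_of_nonneg_left hΔT hκ.le
        have h8 : 0 ≤ κ * (κ * c * (C.Tc - T)) := by positivity
        linarith
  · intro x hx
    rw [approximant, hTc, bernsteinSq_zero_left hδ0, sub_self, mul_zero, mul_zero, add_zero]
  · intro T hT x hx x₁ hx₁
    have hT' : T ∈ Icc C.T₀ C.Tc := ⟨hT.1, hT.2.le⟩
    have h1 := bernsteinSq_ratio (n := n + 1) (ψ := delayed C φ δ) (reversed_time_mem hT')
      (rescaled_energy_mem hx)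
      (rescaled_energy_mem hx₁) fun v hv z hz z' hz' => delayed_ratio hδ.le hφ hv hz hz'
    have h2 := mul_le_mul_of_nonneg_left h1 hκ1'.le
    have hs : 0 ≤ C.Tc - T := sub_nonneg.2 hT'.2
    have h3 : κ * c * (C.Tc - T) ≤ C.a * (κ * c * (C.Tc - T)) :=
      le_mul_of_one_le_left (by positivity) ha
    rw [approximant, approximant]
    linarith
  · intro x hx x₁ hx₁
    have hmem : C.Tc ∈ Icc C.T₀ C.Tc := ⟨C.hT₀₂.le, le_rfl⟩
    rw [pderivT_approximant n hmem, pderivT_approximant n hmem, hTc]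
    have h1 := bernsteinSqDeriv_zero_ratio (n := n) (ψ := delayed C φ δ) (rescaled_energy_mem hx)
      (rescaled_energy_mem hx₁) hδ0 fun v hv z hz z' hz' => delayed_ratio hδ.le hφ hv hz hz'
    have h2 := mul_le_mul_of_nonneg_left (div_le_div_of_nonneg_right h1 hL.le) hκ1'.le
    have h3 : κ * c ≤ C.a * (κ * c) := le_mul_of_one_le_left (by positivity) ha
    rw [mul_div_assoc] at h2
    linarith
  · intro T hT x hx
    rw [pderivT_approximant n hT]
    have h1 := bernsteinSqDeriv_nonneg (n := n) (ψ := delayed C φ δ) (reversed_time_mem hT)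
      (rescaled_energy_mem hx)
      fun v hv v' hv' z hz => delayed_mono hδ.le hφ hv hv' hz
    have : 0 < κ * c := by positivity
    have := mul_nonneg hκ1'.le (div_nonneg h1 hL.le)
    linarith
  · intro T hT x hx
    rw [pderivT_approximant n hT, neg_neg]
    have h1 := bernsteinSqDeriv_le (n := n) (ψ := delayed C φ δ) (reversed_time_mem hT)
      (rescaled_energy_mem hx)
      fun v hv v' hv' z hz => delayed_lip hδ.le hφ hv hv' hz
    rw [← div_le_iff₀ hL] at h1
    have h2 := mul_le_mul_of_nonneg_left h1 hκ1'.le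
    have h3 := mul_le_mul_of_nonneg_left hcM hκ.le
    linarith

lemma dist_approximant_le (hφ : ClosedConstraints C φ)
    (hcont : ContinuousOn (fun p : ℝ × ℝ => φ p.1 p.2) C.Dset) (hδ : 0 < δ) (hκ : 0 < κ)
    (hκ1 : κ < 1) (hc : 0 < c) (hcM : c ≤ C.MT) :
    ∀ᶠ n : ℕ in atTop, ∀ T ∈ Icc C.T₀ C.Tc, ∀ x ∈ C.Iset,
      |approximant C φ c κ δ n T x - φ T x| ≤
        δ + C.MT * δ + 2 * (κ * (C.MT * (C.Tc - C.T₀))) := by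
  have hL := sub_pos.2 C.hT₀₂
  have hM := MT_nonneg_of_closedConstraints hφ
  filter_upwards [(tendsto_add_atTop_nat 1).eventually
    (bernsteinSq_tendsto (delayed_continuousOn hδ.le hcont) hδ)] with n hn T hT x hx
  have hu := reversed_time_mem hT
  have hy := rescaled_energy_mem hx
  have hs : 0 ≤ C.Tc - T := sub_nonneg.2 hT.2
  have hLu : (C.Tc - C.T₀) * ((C.Tc - T) / (C.Tc - C.T₀)) = C.Tc - T := by field_simp
  have hly : C.eps + (C.om - C.eps) * ((x - C.eps) / (C.om - C.eps)) = x := by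
    have := (sub_pos.2 C.hepsom).ne'
    field_simp
    ring
  have h1 := abs_le.1 (hn _ hu _ hy)
  have h2 := delayed_le hδ.le hφ hu hy
  have h3 := le_delayed_add hδ.le hφ hu hy
  rw [hLu, hly, sub_sub_cancel] at h2 h3
  have h0 := bernsteinSq_nonneg (n := n + 1) hu hy fun v hv z hz =>
    delayed_nonneg (δ := δ) hδ.le hφ hv hz
  rw [approximant]
  set b := bernsteinSq (n + 1) (delayed C φ δ) ((C.Tc - T) / (C.Tc - C.T₀))
    ((x - C.eps) / (C.om - C.eps))
  have h4 : φ T x ≤ C.MT * (C.Tc - C.T₀) := by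
    have := hφ.lip x hx T hT C.Tc ⟨C.hT₀₂.le, le_rfl⟩ hT.2
    rw [hφ.zero x hx, sub_zero] at this
    exact this.trans (mul_le_mul_of_nonneg_left (by linarith [hT.1]) hM)
  have h5 : κ * b ≤ κ * (δ + C.MT * (C.Tc - C.T₀)) :=
    mul_le_mul_of_nonneg_left (by linarith) hκ.le
  have h6 : κ * c * (C.Tc - T) ≤ κ * (C.MT * (C.Tc - C.T₀)) := by
    rw [mul_assoc]
    refine mul_le_mul_of_nonneg_left ?_ hκ.le
    exact mul_le_mul hcM (by linarith [hT.1]) hs hM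
  have h7 : 0 ≤ κ * c * (C.Tc - T) := by positivity
  have h8 : 0 ≤ κ * b := by positivity
  have h9 : (1 - κ) * b - φ T x ≤ δ := by linarith
  have h10 : 0 ≤ κ * (C.MT * (C.Tc - C.T₀)) := by positivity
  have h11 : 0 ≤ C.MT * δ := by positivity
  have h12 : κ * φ T x ≤ κ * (C.MT * (C.Tc - C.T₀)) := mul_le_mul_of_nonneg_left h4 hκ.le
  have h13 : φ T x - δ - C.MT * δ ≤ b := by linarith
  have h14 := mul_le_mul_of_nonneg_left h13 (sub_pos.2 hκ1).le
  have h15 : 0 ≤ κ * (δ + C.MT * δ) := by positivity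
  rw [abs_le]
  constructor <;> linarith

end Approximant

lemma mem_closure_WSet (C : BCSContext) {F : C(↥C.Dset, ℝ)}
    (hF : ClosedConstraints C (extFun C F)) {c : ℝ} (hc : 0 < c) (hcM : c ≤ C.MT)
    (hΔ : ∀ T ∈ Icc C.T₀ C.Tc, 2 * c * (C.Tc - T) ≤ C.Δ₂ T ^ 2) : F ∈ closure (WSet C) := by
  have hcont := continuousOn_extFun C F
  rw [Metric.mem_closure_iff]
  intro ε hε
  have hlim : Tendsto (fun t : ℝ => t + C.MT * t + 2 * (t * (C.MT * (C.Tc - C.T₀)))) (𝓝[>] 0)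
      (𝓝 0) := by
    have : Continuous fun t : ℝ => t + C.MT * t + 2 * (t * (C.MT * (C.Tc - C.T₀))) := by fun_prop
    exact (this.tendsto' 0 0 (by ring)).mono_left nhdsWithin_le_nhds
  obtain ⟨t, ht, ht0, ht1⟩ := ((hlim.eventually_lt_const hε).and
    (Ioo_mem_nhdsGT (zero_lt_one' ℝ))).exists
  obtain ⟨n, hn1, hn2⟩ := ((memW_approximant hF hcont ht0 ht0 ht1 hc hcM hΔ).and
    (dist_approximant_le hF hcont ht0 ht0 ht1 hc hcM)).exists
  let G : C(↥C.Dset, ℝ) :=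
    ⟨fun p => approximant C (extFun C F) c t t n (p : ℝ × ℝ).1 (p : ℝ × ℝ).2,
      continuousOn_iff_continuous_domRestrict.1 hn1.1.continuousOn⟩
  refine ⟨G, ⟨_, hn1, fun p => rfl⟩, ?_⟩
  refine lt_of_le_of_lt ?_ ht
  have hM := MT_nonneg_of_closedConstraints hF
  have hL := sub_pos.2 C.hT₀₂
  rw [ContinuousMap.dist_le (by positivity)]
  intro p
  have := hn2 (p : ℝ × ℝ).1 p.2.1 (p : ℝ × ℝ).2 p.2.2
  rw [extFun_apply C F p.2] at this
  rw [dist_comm, Real.dist_eq]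
  exact this

lemma Real.hasDerivAt_tanh' (z : ℝ) : HasDerivAt Real.tanh (1 / Real.cosh z ^ 2) z := by
  have h := (Real.hasDerivAt_sinh z).div (Real.hasDerivAt_cosh z) (Real.cosh_pos z).ne'
  have he : Real.tanh = fun z => Real.sinh z / Real.cosh z := funext Real.tanh_eq_sinh_div_cosh
  rw [he]
  refine h.congr_deriv ?_
  rw [← Real.cosh_sq_sub_sinh_sq z]
  ring

lemma Real.tanh_monotone' : Monotone Real.tanh :=
  monotone_of_deriv_nonneg (fun z => (Real.hasDerivAt_tanh' z).differentiableAt) fun z => by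
    rw [(Real.hasDerivAt_tanh' z).deriv]
    positivity

lemma Real.tanh_nonneg' {z : ℝ} (hz : 0 ≤ z) : 0 ≤ Real.tanh z := by
  simpa using Real.tanh_monotone' hz

lemma Real.continuous_tanh' : Continuous Real.tanh :=
  continuous_iff_continuousAt.2 fun z => (Real.hasDerivAt_tanh' z).continuousAt

/-- The function `tanh z - z / cosh² z`, the numerator of the negated derivative of `tanh z / z`. -/
def tanhGap (z : ℝ) : ℝ := Real.tanh z - z / Real.cosh z ^ 2

lemma hasDerivAt_tanhGap (z : ℝ) :
    HasDerivAt tanhGap (2 * z * Real.sinh z / Real.cosh z ^ 3) z := by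
  have hc := (Real.cosh_pos z).ne'
  have h := (Real.hasDerivAt_tanh' z).sub
    ((hasDerivAt_id z).div ((Real.hasDerivAt_cosh z).pow 2) (pow_ne_zero 2 hc))
  refine h.congr_deriv ?_
  simp only [id, Pi.pow_apply]
  field_simp
  push_cast
  ring

lemma tanhGap_monotoneOn : MonotoneOn tanhGap (Ici 0) := by
  refine monotoneOn_of_deriv_nonneg (convex_Ici 0)
    (fun z _ => (hasDerivAt_tanhGap z).continuousAt.continuousWithinAt)
    (fun z _ => (hasDerivAt_tanhGap z).differentiableAt.differentiableWithinAt) fun z hz => ?_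
  rw [interior_Ici] at hz
  rw [(hasDerivAt_tanhGap z).deriv]
  have h1 : 0 < z := hz
  have h2 := Real.sinh_pos_iff.2 h1
  have h3 := Real.cosh_pos z
  positivity

lemma tanhGap_nonneg {z : ℝ} (hz : 0 ≤ z) : 0 ≤ tanhGap z := by
  have := tanhGap_monotoneOn (mem_Ici.2 le_rfl) (mem_Ici.2 hz) hz
  simpa [tanhGap] using this

lemma tanhGap_le_tanh {z : ℝ} (hz : 0 ≤ z) : tanhGap z ≤ Real.tanh z := by
  have : 0 ≤ z / Real.cosh z ^ 2 := by positivity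
  rw [tanhGap]
  linarith

lemma tanh_div_antitoneOn {t : ℝ} (ht : 0 < t) :
    AntitoneOn (fun E => Real.tanh (E / (2 * t)) / E) (Ioi 0) := by
  have hd : ∀ E : ℝ, 0 < E → HasDerivAt (fun E => Real.tanh (E / (2 * t)) / E)
      (-(tanhGap (E / (2 * t)) / E ^ 2)) E := by
    intro E hE
    have h1 := (hasDerivAt_id E).div_const (2 * t)
    have h2 := ((Real.hasDerivAt_tanh' (E / (2 * t))).comp E h1).div (hasDerivAt_id E) hE.ne'
    refine h2.congr_deriv ?_
    simp only [tanhGap, id, Function.comp]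
    field_simp
    ring
  refine antitoneOn_of_deriv_nonpos (convex_Ioi 0)
    (fun z hz => (hd z hz).continuousAt.continuousWithinAt)
    (fun z hz => (hd z (interior_subset hz)).differentiableAt.differentiableWithinAt) fun z hz => ?_
  have hz' : 0 < z := interior_subset hz
  rw [(hd z hz').deriv, neg_nonpos]
  exact div_nonneg (tanhGap_nonneg (by positivity)) (by positivity)

/-- The integrand of the gap equation, without the potential, as a function of the temperature
`t`, the energy `ξ` and the squared gap `w`. -/
def gapKernel (t ξ w : ℝ) : ℝ :=
  Real.sqrt (w / (ξ ^ 2 + w)) * Real.tanh (Real.sqrt (ξ ^ 2 + w) / (2 * t))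

lemma gapKernel_eq {t ξ w : ℝ} (hw : 0 ≤ w) :
    gapKernel t ξ w =
      Real.sqrt w * (Real.tanh (Real.sqrt (ξ ^ 2 + w) / (2 * t)) / Real.sqrt (ξ ^ 2 + w)) := by
  rw [gapKernel, Real.sqrt_div hw]
  ring

lemma gapKernel_nonneg {t ξ w : ℝ} (ht : 0 ≤ t) : 0 ≤ gapKernel t ξ w :=
  mul_nonneg (Real.sqrt_nonneg _) (Real.tanh_nonneg' (by positivity))

lemma gapKernel_mono {t t' ξ w w' : ℝ} (ht : 0 < t) (htt : t ≤ t') (hξ : 0 < ξ) (hw' : 0 ≤ w')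
    (hww : w' ≤ w) : gapKernel t' ξ w' ≤ gapKernel t ξ w := by
  have hw : 0 ≤ w := hw'.trans hww
  refine mul_le_mul (Real.sqrt_le_sqrt ?_) (Real.tanh_monotone' ?_)
    (Real.tanh_nonneg' (by have := ht.trans_le htt; positivity)) (Real.sqrt_nonneg _)
  · rw [div_le_div_iff₀ (by positivity) (by positivity)]
    nlinarith [sq_nonneg ξ]
  · gcongr

/-- The derivative of `t ↦ gapKernel t ξ (w t)` when `w` has derivative `d`. -/
def gapKernelDeriv (t ξ w d : ℝ) : ℝ :=
  d * (Real.tanh (Real.sqrt (ξ ^ 2 + w) / (2 * t)) / (2 * Real.sqrt w * Real.sqrt (ξ ^ 2 + w))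
      - Real.sqrt w * tanhGap (Real.sqrt (ξ ^ 2 + w) / (2 * t)) / (2 * Real.sqrt (ξ ^ 2 + w) ^ 3))
    - Real.sqrt w / (2 * t ^ 2 * Real.cosh (Real.sqrt (ξ ^ 2 + w) / (2 * t)) ^ 2)

lemma hasDerivAt_gapKernel {w : ℝ → ℝ} {t ξ d : ℝ} (ht : 0 < t) (hξ : 0 < ξ) (hw : 0 < w t)
    (hd : HasDerivAt w d t) :
    HasDerivAt (fun t => gapKernel t ξ (w t)) (gapKernelDeriv t ξ (w t) d) t := by
  have hE2 : 0 < ξ ^ 2 + w t := by positivity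
  have hs := hd.sqrt hw.ne'
  have hE := (hd.const_add (ξ ^ 2)).sqrt hE2.ne'
  have hz := hE.div ((hasDerivAt_id t).const_mul 2) (by simpa using ht.ne')
  have htz := (Real.hasDerivAt_tanh' (Real.sqrt (ξ ^ 2 + w t) / (2 * t))).comp t hz
  have hK := hs.mul (htz.div hE (Real.sqrt_pos.2 hE2).ne')
  have heq : (fun t => gapKernel t ξ (w t)) =ᶠ[𝓝 t]
      fun t => Real.sqrt (w t) *
        (Real.tanh (Real.sqrt (ξ ^ 2 + w t) / (2 * t)) / Real.sqrt (ξ ^ 2 + w t)) := by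
    filter_upwards [hd.continuousAt.eventually_const_lt hw] with s hs
    exact gapKernel_eq hs.le
  refine HasDerivAt.congr_of_eventuallyEq (hK.congr_deriv ?_) heq
  simp only [gapKernelDeriv, tanhGap, id, Function.comp, Pi.div_apply]
  have h1 := Real.sqrt_pos.2 hw
  have h2 := Real.sqrt_pos.2 hE2
  have h3 := Real.cosh_pos (Real.sqrt (ξ ^ 2 + w t) / (2 * t))
  generalize Real.cosh (Real.sqrt (ξ ^ 2 + w t) / (2 * t)) = k at *
  generalize Real.tanh (Real.sqrt (ξ ^ 2 + w t) / (2 * t)) = h at *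
  generalize Real.sqrt (ξ ^ 2 + w t) = E at *
  generalize Real.sqrt (w t) = s at *
  field_simp
  ring

section KernelBounds

variable {t ξ w d M : ℝ}

lemma gapKernelDeriv_coeff_nonneg (ht : 0 < t) (hξ : 0 < ξ) (hw : 0 < w) :
    0 ≤ Real.tanh (Real.sqrt (ξ ^ 2 + w) / (2 * t)) / (2 * Real.sqrt w * Real.sqrt (ξ ^ 2 + w))
      - Real.sqrt w * tanhGap (Real.sqrt (ξ ^ 2 + w) / (2 * t)) /
        (2 * Real.sqrt (ξ ^ 2 + w) ^ 3) := by
  have hE2 : 0 < ξ ^ 2 + w := by positivity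
  have h1 := Real.sqrt_pos.2 hw
  have h2 := Real.sqrt_pos.2 hE2
  have hz : 0 ≤ Real.sqrt (ξ ^ 2 + w) / (2 * t) := by positivity
  have h3 := tanhGap_le_tanh hz
  have h4 := tanhGap_nonneg hz
  have h5 : Real.sqrt w ^ 2 ≤ Real.sqrt (ξ ^ 2 + w) ^ 2 := by
    rw [Real.sq_sqrt hw.le, Real.sq_sqrt hE2.le]
    nlinarith [sq_nonneg ξ]
  generalize Real.tanh (Real.sqrt (ξ ^ 2 + w) / (2 * t)) = h at *
  generalize tanhGap (Real.sqrt (ξ ^ 2 + w) / (2 * t)) = r at *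
  generalize Real.sqrt (ξ ^ 2 + w) = E at *
  generalize Real.sqrt w = s at *
  rw [sub_nonneg, div_le_div_iff₀ (by positivity) (by positivity)]
  have h6 : s ^ 2 * r ≤ E ^ 2 * h := mul_le_mul h5 h3 h4 (by positivity)
  have h7 := mul_le_mul_of_nonneg_right h6 (by positivity : 0 ≤ 2 * E)
  linarith

lemma gapKernelDeriv_nonpos (ht : 0 < t) (hξ : 0 < ξ) (hw : 0 < w) (hd : d ≤ 0) :
    gapKernelDeriv t ξ w d ≤ 0 := by
  have h1 := mul_nonpos_of_nonpos_of_nonneg hd (gapKernelDeriv_coeff_nonneg ht hξ hw)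
  have h2 : 0 ≤ Real.sqrt w / (2 * t ^ 2 * Real.cosh (Real.sqrt (ξ ^ 2 + w) / (2 * t)) ^ 2) := by
    positivity
  rw [gapKernelDeriv]
  linarith

lemma neg_gapKernelDeriv_le (ht : 0 < t) (hξ : 0 < ξ) (hw : 0 < w) (hd : -d ≤ M) :
    -gapKernelDeriv t ξ w d ≤ -gapKernelDeriv t ξ w (-M) := by
  have h1 := mul_le_mul_of_nonneg_right hd (gapKernelDeriv_coeff_nonneg ht hξ hw)
  rw [gapKernelDeriv, gapKernelDeriv]
  linarith

lemma neg_gapKernelDeriv_le_refined {σ S m Δ N : ℝ} (ht : 0 < t) (hξ : 0 < ξ) (hw : 0 < w)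
    (hM : 0 ≤ M) (hd : -d ≤ M) (hσ : 0 < σ) (hσw : σ ≤ Real.sqrt w) (hwS : Real.sqrt w ≤ S)
    (hm : 0 ≤ m) (hm' : m ≤ tanhGap (Real.sqrt (ξ ^ 2 + w) / (2 * t))) (hΔ : w ≤ Δ ^ 2)
    (hN : ∀ z : ℝ, 0 ≤ z → z / Real.cosh z ≤ N) :
    -gapKernelDeriv t ξ w d ≤ M / (2 * σ) * (Real.tanh (ξ / (2 * t)) / ξ)
      - M * σ * (m / 2) * (ξ ^ 2 + Δ ^ 2) ^ (-(3 : ℝ) / 2) + 2 * S * N ^ 2 * (1 / ξ ^ 2) := by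
  have hE2 : 0 < ξ ^ 2 + w := by positivity
  have hs := Real.sqrt_pos.2 hw
  have hE := Real.sqrt_pos.2 hE2
  have hEξ : ξ ≤ Real.sqrt (ξ ^ 2 + w) := Real.le_sqrt_of_sq_le (by linarith)
  set E := Real.sqrt (ξ ^ 2 + w) with hEdef
  set s := Real.sqrt w
  have hz : 0 ≤ E / (2 * t) := by positivity
  have h1 : Real.tanh (E / (2 * t)) / (2 * s * E) ≤
      1 / (2 * σ) * (Real.tanh (ξ / (2 * t)) / ξ) := by
    have ha := tanh_div_antitoneOn ht (mem_Ioi.2 hξ) (mem_Ioi.2 hE) hEξ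
    simp only at ha
    have hb : 0 ≤ Real.tanh (E / (2 * t)) / E := div_nonneg (Real.tanh_nonneg' hz) hE.le
    calc Real.tanh (E / (2 * t)) / (2 * s * E) = 1 / (2 * s) * (Real.tanh (E / (2 * t)) / E) := by
          field_simp
      _ ≤ 1 / (2 * σ) * (Real.tanh (ξ / (2 * t)) / ξ) := by gcongr
  have h2 : σ * (m / 2) * (ξ ^ 2 + Δ ^ 2) ^ (-(3 : ℝ) / 2) ≤
      s * tanhGap (E / (2 * t)) / (2 * E ^ 3) := by
    have ha : (ξ ^ 2 + Δ ^ 2) ^ (-(3 : ℝ) / 2) ≤ (ξ ^ 2 + w) ^ (-(3 : ℝ) / 2) :=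
      Real.rpow_le_rpow_of_nonpos hE2 (by linarith) (by norm_num)
    have hb : (ξ ^ 2 + w) ^ (-(3 : ℝ) / 2) = 1 / E ^ 3 := by
      rw [hEdef]
      generalize ξ ^ 2 + w = X at hE2
      rw [Real.sqrt_eq_rpow, ← Real.rpow_natCast, ← Real.rpow_mul hE2.le, one_div,
        ← Real.rpow_neg hE2.le]
      norm_num
    rw [hb] at ha
    have hr := tanhGap_nonneg hz
    have hr' : 0 ≤ s * (tanhGap (E / (2 * t)) / 2) := by positivity
    calc σ * (m / 2) * (ξ ^ 2 + Δ ^ 2) ^ (-(3 : ℝ) / 2)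
        ≤ s * (tanhGap (E / (2 * t)) / 2) * (1 / E ^ 3) := by gcongr
      _ = s * tanhGap (E / (2 * t)) / (2 * E ^ 3) := by field_simp
  have h3 : s / (2 * t ^ 2 * Real.cosh (E / (2 * t)) ^ 2) ≤ 2 * S * N ^ 2 * (1 / ξ ^ 2) := by
    have hc := Real.cosh_pos (E / (2 * t))
    have ha := hN _ hz
    have hS : 0 ≤ S := hs.le.trans hwS
    have hS' : 0 ≤ 2 * S * N ^ 2 := by positivity
    have hq : 0 ≤ E / (2 * t) / Real.cosh (E / (2 * t)) := by positivity
    calc s / (2 * t ^ 2 * Real.cosh (E / (2 * t)) ^ 2)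
        = 2 * s * (E / (2 * t) / Real.cosh (E / (2 * t))) ^ 2 * (1 / E ^ 2) := by field_simp
      _ ≤ 2 * S * N ^ 2 * (1 / ξ ^ 2) := by gcongr
  have h4 := neg_gapKernelDeriv_le (M := M) ht hξ hw hd
  have h8 : -gapKernelDeriv t ξ w (-M) = M * (Real.tanh (E / (2 * t)) / (2 * s * E))
      - M * (s * tanhGap (E / (2 * t)) / (2 * E ^ 3))
      + s / (2 * t ^ 2 * Real.cosh (E / (2 * t)) ^ 2) := by
    rw [gapKernelDeriv]
    ring
  have h5 := mul_le_mul_of_nonneg_left h1 hM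
  have h6 := mul_le_mul_of_nonneg_left h2 hM
  have h7 : M / (2 * σ) * (Real.tanh (ξ / (2 * t)) / ξ)
      = M * (1 / (2 * σ) * (Real.tanh (ξ / (2 * t)) / ξ)) := by ring
  rw [h7]
  linarith

end KernelBounds

section ContinuousOperator

lemma continuous_gapKernel {X : Type*} [TopologicalSpace X] {t ξ w : X → ℝ} (ht : Continuous t)
    (hξ : Continuous ξ) (hw : Continuous w) (ht0 : ∀ q, 0 < t q) (hξ0 : ∀ q, 0 < ξ q)
    (hw0 : ∀ q, 0 ≤ w q) : Continuous fun q => gapKernel (t q) (ξ q) (w q) := by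
  unfold gapKernel
  refine Continuous.mul (Real.continuous_sqrt.comp (hw.div (by fun_prop) fun q => ?_))
    (Real.continuous_tanh'.comp (Continuous.div (by fun_prop) (by fun_prop) fun q => ?_))
  · have := hξ0 q
    have := hw0 q
    positivity
  · have := ht0 q
    positivity

variable (C : BCSContext)

/-- The clamped energy, so that the integrand is defined for all real `ξ`. -/
def clampedEnergy (ξ : ℝ) : ℝ := projIcc C.eps C.om C.hepsom.le ξ

lemma clampedEnergy_mem (ξ : ℝ) : clampedEnergy C ξ ∈ Icc C.eps C.om :=
  (projIcc C.eps C.om C.hepsom.le ξ).2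

lemma clampedEnergy_of_mem {ξ : ℝ} (hξ : ξ ∈ Icc C.eps C.om) : clampedEnergy C ξ = ξ := by
  rw [clampedEnergy, projIcc_of_mem _ hξ]

lemma continuous_clampedEnergy : Continuous (clampedEnergy C) :=
  continuous_subtype_val.comp continuous_projIcc

lemma continuous_opIntegral : Continuous fun q : C(↥C.Dset, ℝ) × ↥C.Dset =>
    (∫ ξ in C.eps..C.om, C.U q.2.1.2 (clampedEnergy C ξ) * gapKernel q.2.1.1 (clampedEnergy C ξ)
      (max (q.1 ⟨(q.2.1.1, clampedEnergy C ξ), q.2.2.1, clampedEnergy_mem C ξ⟩) 0)) ^ 2 := by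
  have hc := continuous_clampedEnergy C
  refine (intervalIntegral.continuous_parametric_intervalIntegral_of_continuous' ?_ _ _).pow 2
  refine Continuous.mul ?_ (continuous_gapKernel (by fun_prop) (by fun_prop) ?_
    (fun q => C.T₀_pos.trans_le q.1.2.2.1.1)
    (fun q => C.heps.trans_le (clampedEnergy_mem C q.2).1) fun q => le_max_right _ _)
  · exact C.hUsmooth.continuousOn.comp_continuous
      (f := fun q : (C(↥C.Dset, ℝ) × ↥C.Dset) × ℝ => (q.1.2.1.2, clampedEnergy C q.2))
      (by fun_prop) fun q => ⟨q.1.2.2.2, clampedEnergy_mem C q.2⟩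
  · refine Continuous.max (Continuous.eval (by fun_prop) ?_) continuous_const
    exact Continuous.subtype_mk (by fun_prop) _

/-- The operator `A`, as a continuous map of the Banach space `C(D)`. -/
def opAMap : C(C(↥C.Dset, ℝ), C(↥C.Dset, ℝ)) :=
  ContinuousMap.curry ⟨_, continuous_opIntegral C⟩

variable {C}

lemma opA_congr {f g : ℝ → ℝ → ℝ} {T : ℝ} (h : ∀ ξ ∈ C.Iset, f T ξ = g T ξ) (x : ℝ) :
    opA C f T x = opA C g T x := by
  unfold opA
  congr 1
  refine intervalIntegral.integral_congr fun ξ hξ => ?_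
  rw [uIcc_of_le C.hepsom.le] at hξ
  simp only [h ξ hξ]

lemma opA_eq_opAMap {F : C(↥C.Dset, ℝ)} (hF : ∀ p, 0 ≤ F p) {T x : ℝ} (h : (T, x) ∈ C.Dset) :
    opA C (extFun C F) T x = extFun C (opAMap C F) T x := by
  rw [extFun_apply C _ h]
  change _ = (∫ ξ in C.eps..C.om, (_ : ℝ)) ^ 2
  rw [opA]
  congr 1
  refine intervalIntegral.integral_congr fun ξ hξ => ?_
  rw [uIcc_of_le C.hepsom.le] at hξ
  simp only [clampedEnergy_of_mem C hξ, extFun_apply C F (show (T, ξ) ∈ C.Dset from ⟨h.1, hξ⟩),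
    gapKernel, max_eq_left (hF _), mul_assoc]

end ContinuousOperator

lemma continuousOn_gapKernel {X : Type*} [TopologicalSpace X] {t ξ w : X → ℝ} {s : Set X}
    (ht : ContinuousOn t s) (hξ : ContinuousOn ξ s) (hw : ContinuousOn w s)
    (ht0 : ∀ q ∈ s, 0 < t q) (hξ0 : ∀ q ∈ s, 0 < ξ q) (hw0 : ∀ q ∈ s, 0 ≤ w q) :
    ContinuousOn (fun q => gapKernel (t q) (ξ q) (w q)) s :=
  continuousOn_iff_continuous_domRestrict.2 <| continuous_gapKernel
    (continuousOn_iff_continuous_domRestrict.1 ht) (continuousOn_iff_continuous_domRestrict.1 hξ)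
    (continuousOn_iff_continuous_domRestrict.1 hw) (fun q => ht0 q q.2) (fun q => hξ0 q q.2)
    fun q => hw0 q q.2

lemma continuous_tanhGap : Continuous tanhGap :=
  continuous_iff_continuousAt.2 fun z => (hasDerivAt_tanhGap z).continuousAt

lemma continuousOn_gapKernelDeriv {t : ℝ} {w d : ℝ → ℝ} {s : Set ℝ} (ht : 0 < t)
    (hw : ContinuousOn w s) (hd : ContinuousOn d s) (hs0 : ∀ ξ ∈ s, 0 < ξ)
    (hw0 : ∀ ξ ∈ s, 0 < w ξ) :
    ContinuousOn (fun ξ => gapKernelDeriv t ξ (w ξ) (d ξ)) s := by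
  have hsw : ContinuousOn (fun ξ => Real.sqrt (w ξ)) s := Real.continuous_sqrt.comp_continuousOn hw
  have hE : ContinuousOn (fun ξ => Real.sqrt (ξ ^ 2 + w ξ)) s :=
    Real.continuous_sqrt.comp_continuousOn (by fun_prop)
  have hz := hE.div_const (2 * t)
  have hE0 : ∀ ξ ∈ s, 0 < Real.sqrt (ξ ^ 2 + w ξ) := fun ξ hξ => by
    have := hs0 ξ hξ
    have := hw0 ξ hξ
    positivity
  have hc := Real.continuous_cosh.comp_continuousOn hz
  have ht' := Real.continuous_tanh'.comp_continuousOn hz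
  have hg := continuous_tanhGap.comp_continuousOn hz
  simp only [Function.comp_def] at hc ht' hg
  unfold gapKernelDeriv
  refine ((hd.mul ((ht'.div (by fun_prop) fun ξ hξ => ?_).sub
    ((hsw.mul hg).div (by fun_prop) fun ξ hξ => ?_))).sub
    (hsw.div (by fun_prop) fun ξ hξ => ?_))
  · have := hE0 ξ hξ
    have := hw0 ξ hξ
    positivity
  · have := hE0 ξ hξ
    positivity
  · have := Real.cosh_pos (Real.sqrt (ξ ^ 2 + w ξ) / (2 * t))
    positivity

namespace memW

variable {C : BCSContext} {f : ℝ → ℝ → ℝ}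

lemma contDiffOn_time (hf : memW C f) {x : ℝ} (hx : x ∈ C.Iset) :
    ContDiffOn ℝ 2 (fun T => f T x) (Icc C.T₀ C.Tc) :=
  hf.1.comp (f := fun T : ℝ => (T, x)) (by fun_prop) fun _ hT => ⟨hT, hx⟩

lemma continuousOn_energy (hf : memW C f) {T : ℝ} (hT : T ∈ Icc C.T₀ C.Tc) :
    ContinuousOn (fun ξ => f T ξ) (Icc C.eps C.om) :=
  hf.1.continuousOn.comp (f := fun ξ : ℝ => (T, ξ)) (by fun_prop) fun _ hξ => ⟨hT, hξ⟩

lemma hasDerivWithinAt (hf : memW C f) {T x : ℝ} (hT : T ∈ Icc C.T₀ C.Tc) (hx : x ∈ C.Iset) :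
    HasDerivWithinAt (fun s => f s x) (pderivT C f T x) (Icc C.T₀ C.Tc) T :=
  ((hf.contDiffOn_time hx).differentiableOn (by norm_num) T hT).hasDerivWithinAt

lemma hasDerivAt (hf : memW C f) {T x : ℝ} (hT : T ∈ Ioo C.T₀ C.Tc) (hx : x ∈ C.Iset) :
    HasDerivAt (fun s => f s x) (pderivT C f T x) T :=
  (hf.hasDerivWithinAt (Ioo_subset_Icc_self hT) hx).hasDerivAt (Icc_mem_nhds hT.1 hT.2)

lemma strictAntiOn (hf : memW C f) {x : ℝ} (hx : x ∈ C.Iset) :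
    StrictAntiOn (fun T => f T x) (Icc C.T₀ C.Tc) := by
  refine strictAntiOn_of_deriv_neg (convex_Icc _ _) (hf.contDiffOn_time hx).continuousOn
    fun T hT => ?_
  rw [interior_Icc] at hT
  rw [(hf.hasDerivAt hT hx).deriv]
  exact hf.2.2.2.2.2.1 T (Ioo_subset_Icc_self hT) x hx

lemma nonneg (hf : memW C f) {T x : ℝ} (hT : T ∈ Icc C.T₀ C.Tc) (hx : x ∈ C.Iset) : 0 ≤ f T x :=
  (sq_nonneg _).trans (hf.2.1 T hT x hx).1

lemma pos (hf : memW C f) {T x : ℝ} (hT : T ∈ Ico C.T₀ C.Tc) (hx : x ∈ C.Iset) : 0 < f T x := by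
  have h := hf.strictAntiOn hx (Ico_subset_Icc_self hT) (right_mem_Icc.2 C.hT₀₂.le) hT.2
  simpa only [hf.2.2.1 x hx] using h

lemma MT_pos (hf : memW C f) : 0 < C.MT := by
  have hT : C.T₀ ∈ Icc C.T₀ C.Tc := left_mem_Icc.2 C.hT₀₂.le
  have hx : C.eps ∈ C.Iset := left_mem_Icc.2 C.hepsom.le
  linarith [hf.2.2.2.2.2.1 _ hT _ hx, hf.2.2.2.2.2.2 _ hT _ hx]

lemma exists_linear_le_sq (hf : memW C f) :
    ∃ c, 0 < c ∧ c ≤ C.MT ∧ ∀ T ∈ Icc C.T₀ C.Tc, 2 * c * (C.Tc - T) ≤ C.Δ₂ T ^ 2 := by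
  have hx : C.eps ∈ C.Iset := left_mem_Icc.2 C.hepsom.le
  have hcont : ContinuousOn (fun T => pderivT C f T C.eps) (Icc C.T₀ C.Tc) :=
    (hf.contDiffOn_time hx).continuousOn_derivWithin (uniqueDiffOn_Icc C.hT₀₂) (by norm_num)
  obtain ⟨S, hS, hmax⟩ := isCompact_Icc.exists_isMaxOn (nonempty_Icc.2 C.hT₀₂.le) hcont
  have hneg := hf.2.2.2.2.2.1 S hS _ hx
  have hM := hf.2.2.2.2.2.2 S hS _ hx
  refine ⟨-pderivT C f S C.eps / 2, by linarith, by linarith, fun T hT => ?_⟩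
  refine le_trans ?_ (hf.2.1 T hT _ hx).2
  have h := (convex_Icc C.T₀ C.Tc).image_sub_le_mul_sub_of_deriv_le
    (hf.contDiffOn_time hx).continuousOn (f := fun T => f T C.eps) (C := pderivT C f S C.eps)
    (fun t ht =>
      (hf.hasDerivAt (by rwa [interior_Icc] at ht) hx).differentiableAt.differentiableWithinAt)
    (fun t ht => by
      rw [(hf.hasDerivAt (by rwa [interior_Icc] at ht) hx).deriv]
      exact hmax (interior_subset ht)) T hT C.Tc (right_mem_Icc.2 C.hT₀₂.le) hT.2
  simp only [hf.2.2.1 _ hx] at h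
  linarith

lemma continuousOn_pderivT (hf : memW C f) {T : ℝ} (hT : T ∈ Icc C.T₀ C.Tc) :
    ContinuousOn (fun ξ => pderivT C f T ξ) (Icc C.eps C.om) := by
  have hD : UniqueDiffOn ℝ C.Dset := (uniqueDiffOn_Icc C.hT₀₂).prod (uniqueDiffOn_Icc C.hepsom)
  have h1 := (hf.1.continuousOn_fderivWithin hD (by norm_num)).comp
    (f := fun ξ : ℝ => (T, ξ)) (t := C.Dset) (s := Icc C.eps C.om) (by fun_prop)
    fun ξ hξ => ⟨hT, hξ⟩
  refine (h1.clm_apply (continuousOn_const (c := ((1 : ℝ), (0 : ℝ))))).congr fun ξ hξ => ?_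
  have h2 := (hf.1.differentiableOn (by norm_num) (T, ξ) ⟨hT, hξ⟩).hasFDerivWithinAt
  have h3 := h2.comp_hasDerivWithinAt (f := fun s : ℝ => (s, ξ)) T (s := Icc C.T₀ C.Tc)
    ((hasDerivWithinAt_id T _).prodMk (hasDerivWithinAt_const T _ ξ)) fun s hs => ⟨hs, hξ⟩
  exact h3.derivWithin (uniqueDiffOn_Icc C.hT₀₂ T hT)

end memW

/-- The integral whose square is `A f (T, x)`. -/
def gapIntegral (C : BCSContext) (f : ℝ → ℝ → ℝ) (T x : ℝ) : ℝ :=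
  ∫ ξ in C.eps..C.om, C.U x ξ * gapKernel T ξ (f T ξ)

lemma opA_eq_sq (C : BCSContext) (f : ℝ → ℝ → ℝ) (T x : ℝ) :
    opA C f T x = gapIntegral C f T x ^ 2 := by
  simp only [opA, gapIntegral, gapKernel, mul_assoc]

namespace BCSContext

variable (C : BCSContext)

lemma continuousOn_U {x : ℝ} (hx : x ∈ C.Iset) : ContinuousOn (C.U x) (Icc C.eps C.om) :=
  C.hUsmooth.continuousOn.comp (f := fun ξ : ℝ => (x, ξ)) (by fun_prop) fun _ hξ => ⟨hx, hξ⟩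

lemma U_pos {x ξ : ℝ} (hx : x ∈ C.Iset) (hξ : ξ ∈ Icc C.eps C.om) : 0 < C.U x ξ :=
  C.hU₁pos.trans_le (C.hUlb x hx ξ hξ)

lemma div_cosh_le {z : ℝ} (hz : 0 ≤ z) : z / Real.cosh z ≤ C.Mz := C.hMz.2 ⟨z, hz, rfl⟩

lemma Δ₂_le_zero {T : ℝ} (hT : T ∈ Icc C.T₀ C.Tc) : C.Δ₂ T ^ 2 ≤ C.Δ₂ 0 ^ 2 := by
  have h0 := C.T₀_pos.trans_le hT.1
  refine pow_le_pow_left₀ (C.hΔ₂nonneg T) ?_ 2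
  exact C.hΔ₂anti.antitoneOn ⟨le_rfl, C.htau₂pos.le⟩ ⟨h0.le, hT.2.trans C.hTc₂⟩ h0.le

end BCSContext

namespace memW

variable {C : BCSContext} {f : ℝ → ℝ → ℝ}

lemma continuousOn_integrand (hf : memW C f) {T x : ℝ} (hT : T ∈ Icc C.T₀ C.Tc)
    (hx : x ∈ C.Iset) :
    ContinuousOn (fun ξ => C.U x ξ * gapKernel T ξ (f T ξ)) (Icc C.eps C.om) :=
  (C.continuousOn_U hx).mul <| continuousOn_gapKernel continuousOn_const continuousOn_id
    (hf.continuousOn_energy hT) (fun _ _ => C.T₀_pos.trans_le hT.1)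
    (fun _ hξ => C.heps.trans_le hξ.1) fun _ hξ => hf.nonneg hT hξ

lemma continuousOn_integrand_deriv (hf : memW C f) {T x : ℝ} (hT : T ∈ Ioo C.T₀ C.Tc)
    (hx : x ∈ C.Iset) :
    ContinuousOn (fun ξ => C.U x ξ * gapKernelDeriv T ξ (f T ξ) (pderivT C f T ξ))
      (Icc C.eps C.om) :=
  (C.continuousOn_U hx).mul <| continuousOn_gapKernelDeriv (C.T₀_pos.trans hT.1)
    (hf.continuousOn_energy (Ioo_subset_Icc_self hT))
    (hf.continuousOn_pderivT (Ioo_subset_Icc_self hT))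
    (fun _ hξ => C.heps.trans_le hξ.1) fun _ hξ => hf.pos (Ioo_subset_Ico_self hT) hξ

/-- At a fixed temperature, the square roots of the values of `f` are comparable. -/
lemma exists_sqrt_bounds (hf : memW C f) {T : ℝ} (hT : T ∈ Ico C.T₀ C.Tc) :
    ∃ σ, 0 < σ ∧ ∀ ξ ∈ Icc C.eps C.om,
      σ ≤ Real.sqrt (f T ξ) ∧ Real.sqrt (f T ξ) ≤ Real.sqrt C.a * σ := by
  obtain ⟨y, hy, hmin⟩ := isCompact_Icc.exists_isMinOn (nonempty_Icc.2 C.hepsom.le)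
    (hf.continuousOn_energy (Ico_subset_Icc_self hT))
  refine ⟨Real.sqrt (f T y), Real.sqrt_pos.2 (hf.pos hT hy), fun ξ hξ =>
    ⟨Real.sqrt_le_sqrt (hmin hξ), ?_⟩⟩
  rw [← Real.sqrt_mul (zero_le_one.trans C.one_le_a)]
  exact Real.sqrt_le_sqrt (hf.2.2.2.1 T hT ξ hξ y hy)

lemma hasDerivAt_gapIntegral (hf : memW C f) {T x : ℝ} (hT : T ∈ Ioo C.T₀ C.Tc)
    (hx : x ∈ C.Iset) :
    HasDerivAt (fun t => gapIntegral C f t x)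
      (∫ ξ in C.eps..C.om, C.U x ξ * gapKernelDeriv T ξ (f T ξ) (pderivT C f T ξ)) T := by
  obtain ⟨t₁, ht₁, ht₁'⟩ := exists_between hT.2
  have hsub : Ioo C.T₀ t₁ ⊆ Ioo C.T₀ C.Tc := Ioo_subset_Ioo_right ht₁'.le
  have ht₁mem : t₁ ∈ Ico C.T₀ C.Tc := ⟨(hT.1.trans ht₁).le, ht₁'⟩
  obtain ⟨σ, hσ, hσf⟩ := hf.exists_sqrt_bounds ht₁mem
  have hI : uIcc C.eps C.om = Icc C.eps C.om := uIcc_of_le C.hepsom.le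
  have hI' : uIoc C.eps C.om ⊆ Icc C.eps C.om := by
    rw [uIoc_of_le C.hepsom.le]
    exact Ioc_subset_Icc_self
  have hmeas : ∀ g : ℝ → ℝ, ContinuousOn g (Icc C.eps C.om) →
      AEStronglyMeasurable g (volume.restrict (uIoc C.eps C.om)) := fun g hg =>
    (hg.mono hI').aestronglyMeasurable measurableSet_uIoc
  have hM := hf.MT_pos
  have hnhds : Ioo C.T₀ t₁ ∈ 𝓝 T := Ioo_mem_nhds hT.1 ht₁
  refine (intervalIntegral.hasDerivAt_integral_of_dominated_loc_of_deriv_le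
    (F := fun t ξ => C.U x ξ * gapKernel t ξ (f t ξ))
    (F' := fun t ξ => C.U x ξ * gapKernelDeriv t ξ (f t ξ) (pderivT C f t ξ))
    (bound := fun _ => C.U₂ * (C.MT / (2 * σ) * (1 / C.eps) +
      2 * Real.sqrt (C.Δ₂ 0 ^ 2) * C.Mz ^ 2 * (1 / C.eps ^ 2)))
    hnhds ?_ ?_ ?_ ?_ ?_ ?_).2
  · filter_upwards [hnhds] with t ht
    exact hmeas _ (hf.continuousOn_integrand (Ioo_subset_Icc_self (hsub ht)) hx)
  · refine ContinuousOn.intervalIntegrable ?_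
    rw [hI]
    exact hf.continuousOn_integrand (Ioo_subset_Icc_self hT) hx
  · exact hmeas _ (hf.continuousOn_integrand_deriv hT hx)
  · refine Eventually.of_forall fun ξ hξ t ht => ?_
    replace hξ := hI' hξ
    have htc := Ioo_subset_Icc_self (hsub ht)
    have ht0 : 0 < t := C.T₀_pos.trans ht.1
    have hξ0 : 0 < ξ := C.heps.trans_le hξ.1
    have hw := hf.pos (Ioo_subset_Ico_self (hsub ht)) hξ
    have hwσ : σ ≤ Real.sqrt (f t ξ) := (hσf ξ hξ).1.trans <| Real.sqrt_le_sqrt <|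
      (hf.strictAntiOn hξ).antitoneOn htc (Ico_subset_Icc_self ht₁mem) ht.2.le
    have hwΔ : f t ξ ≤ C.Δ₂ 0 ^ 2 := (hf.2.1 t htc ξ hξ).2.trans (C.Δ₂_le_zero htc)
    have h1 := neg_gapKernelDeriv_le_refined ht0 hξ0 hw hM.le (hf.2.2.2.2.2.2 t htc ξ hξ) hσ hwσ
      (Real.sqrt_le_sqrt hwΔ) le_rfl (tanhGap_nonneg (by positivity)) hwΔ
      fun z hz => C.div_cosh_le hz
    have h2 := gapKernelDeriv_nonpos ht0 hξ0 hw (hf.2.2.2.2.2.1 t htc ξ hξ).le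
    have h3 := C.U_pos hx hξ
    rw [norm_mul, Real.norm_of_nonneg h3.le, Real.norm_of_nonpos h2]
    refine mul_le_mul (C.hUub x hx ξ hξ) (h1.trans ?_) (neg_nonneg.2 h2)
      (h3.le.trans (C.hUub x hx ξ hξ))
    have h4 : Real.tanh (ξ / (2 * t)) / ξ ≤ 1 / C.eps :=
      div_le_div₀ zero_le_one (Real.tanh_lt_one _).le C.heps hξ.1
    have h5 : 1 / ξ ^ 2 ≤ 1 / C.eps ^ 2 :=
      one_div_le_one_div_of_le (pow_pos C.heps 2) (pow_le_pow_left₀ C.heps.le hξ.1 2)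
    rw [zero_div, mul_zero, zero_mul, sub_zero]
    gcongr
  · exact intervalIntegrable_const
  · refine Eventually.of_forall fun ξ hξ t ht => ?_
    replace hξ := hI' hξ
    exact (hasDerivAt_gapKernel (w := fun s => f s ξ) (C.T₀_pos.trans ht.1) (C.heps.trans_le hξ.1)
      (hf.pos (Ioo_subset_Ico_self (hsub ht)) hξ) (hf.hasDerivAt (hsub ht) hξ)).const_mul _

end memW

namespace memW

variable {C : BCSContext} {f : ℝ → ℝ → ℝ}

/-- The identity defining `M_T`, available because a nonempty `W` forces `M_T ≠ 0`. -/
lemma MT_mul (hf : memW C f) :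
    C.MT * (C.eps * C.U₁ * tanhGap (C.eps / (2 * C.Tc)) *
      ∫ ξ in C.eps..C.om, (ξ ^ 2 + C.Δ₂ 0 ^ 2) ^ (-(3 : ℝ) / 2)) = 4 * C.a * C.U₂ * C.Mz ^ 2 := by
  have h := hf.MT_pos.ne'
  rw [C.hMT] at h ⊢
  exact div_mul_cancel₀ _ fun h0 => h (by rw [h0, div_zero])

lemma gapIntegral_nonneg {T x : ℝ} (hT : T ∈ Icc C.T₀ C.Tc) (hx : x ∈ C.Iset) :
    0 ≤ gapIntegral C f T x :=
  intervalIntegral.integral_nonneg C.hepsom.le fun _ hξ =>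
    mul_nonneg (C.U_pos hx hξ).le (gapKernel_nonneg (C.T₀_pos.le.trans hT.1))

lemma intervalIntegrable_linear {T x : ℝ} (hx : x ∈ C.Iset) :
    IntervalIntegrable (fun ξ => C.U x ξ / ξ * Real.tanh (ξ / (2 * T))) volume C.eps C.om := by
  refine ContinuousOn.intervalIntegrable ?_
  rw [uIcc_of_le C.hepsom.le]
  exact ((C.continuousOn_U hx).div continuousOn_id fun ξ hξ => (C.heps.trans_le hξ.1).ne').mul
    (Real.continuous_tanh'.comp_continuousOn (by fun_prop))

lemma gapIntegral_le (hf : memW C f) {T x S : ℝ} (hT : T ∈ Icc C.T₀ C.Tc) (hx : x ∈ C.Iset)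
    (hS : ∀ ξ ∈ Icc C.eps C.om, Real.sqrt (f T ξ) ≤ S) :
    gapIntegral C f T x ≤ S * ∫ ξ in C.eps..C.om, C.U x ξ / ξ * Real.tanh (ξ / (2 * T)) := by
  have hT0 := C.T₀_pos.trans_le hT.1
  rw [← intervalIntegral.integral_const_mul]
  refine intervalIntegral.integral_mono_on C.hepsom.le
    (ContinuousOn.intervalIntegrable (by
      rw [uIcc_of_le C.hepsom.le]
      exact hf.continuousOn_integrand hT hx))
    ((intervalIntegrable_linear hx).const_mul _) fun ξ hξ => ?_
  have hξ0 := C.heps.trans_le hξ.1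
  have hw := hf.nonneg hT hξ
  have hU := C.U_pos hx hξ
  have hE : ξ ≤ Real.sqrt (ξ ^ 2 + f T ξ) := Real.le_sqrt_of_sq_le (by linarith)
  have hE0 := hξ0.trans_le hE
  have h1 := tanh_div_antitoneOn hT0 (mem_Ioi.2 hξ0) (mem_Ioi.2 hE0) hE
  simp only at h1
  have h2 : 0 ≤ Real.tanh (Real.sqrt (ξ ^ 2 + f T ξ) / (2 * T)) / Real.sqrt (ξ ^ 2 + f T ξ) :=
    div_nonneg (Real.tanh_nonneg' (by positivity)) hE0.le
  have hS0 : 0 ≤ S := (Real.sqrt_nonneg _).trans (hS ξ hξ)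
  rw [gapKernel_eq hw]
  calc C.U x ξ * (Real.sqrt (f T ξ) * (Real.tanh (Real.sqrt (ξ ^ 2 + f T ξ) / (2 * T)) /
        Real.sqrt (ξ ^ 2 + f T ξ)))
      ≤ C.U x ξ * (S * (Real.tanh (ξ / (2 * T)) / ξ)) :=
        mul_le_mul_of_nonneg_left (mul_le_mul (hS ξ hξ) h1 h2 hS0) hU.le
    _ = S * (C.U x ξ / ξ * Real.tanh (ξ / (2 * T))) := by ring

lemma neg_integral_deriv_le (hf : memW C f) {T x σ : ℝ} (hT : T ∈ Ioo C.T₀ C.Tc)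
    (hx : x ∈ C.Iset) (hσ : 0 < σ) (hσf : ∀ ξ ∈ Icc C.eps C.om,
      σ ≤ Real.sqrt (f T ξ) ∧ Real.sqrt (f T ξ) ≤ Real.sqrt C.a * σ) :
    -(∫ ξ in C.eps..C.om, C.U x ξ * gapKernelDeriv T ξ (f T ξ) (pderivT C f T ξ)) ≤
      C.MT / (2 * σ) * ∫ ξ in C.eps..C.om, C.U x ξ / ξ * Real.tanh (ξ / (2 * T)) := by
  have hTc := Ioo_subset_Icc_self hT
  have hT0 := C.T₀_pos.trans hT.1
  have hM := hf.MT_pos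
  have hU₂ := C.hU₁pos.trans_le C.hU₁₂
  have hm0 : 0 ≤ tanhGap (C.eps / (2 * C.Tc)) :=
    tanhGap_nonneg (div_nonneg C.heps.le (by linarith [hT.2]))
  set m := tanhGap (C.eps / (2 * C.Tc)) with hm
  set Γ := ∫ ξ in C.eps..C.om, C.U x ξ / ξ * Real.tanh (ξ / (2 * T))
  set J := ∫ ξ in C.eps..C.om, (ξ ^ 2 + C.Δ₂ 0 ^ 2) ^ (-(3 : ℝ) / 2) with hJ
  have hI : uIcc C.eps C.om = Icc C.eps C.om := uIcc_of_le C.hepsom.le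
  have hJint : IntervalIntegrable (fun ξ : ℝ => (ξ ^ 2 + C.Δ₂ 0 ^ 2) ^ (-(3 : ℝ) / 2)) volume
      C.eps C.om := by
    refine ContinuousOn.intervalIntegrable ?_
    rw [hI]
    refine ContinuousOn.rpow_const (by fun_prop) fun ξ hξ => Or.inl ?_
    have := C.heps.trans_le hξ.1
    positivity
  have hQint : IntervalIntegrable (fun ξ : ℝ => 1 / ξ ^ 2) volume C.eps C.om := by
    refine ContinuousOn.intervalIntegrable ?_
    rw [hI]
    exact continuousOn_const.div (by fun_prop) fun ξ hξ => pow_ne_zero 2 (C.heps.trans_le hξ.1).ne'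
  have hQ : ∫ ξ in C.eps..C.om, 1 / ξ ^ 2 ≤ 1 / C.eps := by
    have h : ∫ ξ in C.eps..C.om, 1 / ξ ^ 2 = -(1 / C.om) - -(1 / C.eps) := by
      refine intervalIntegral.integral_eq_sub_of_hasDerivAt (f := fun ξ : ℝ => -(1 / ξ))
        (fun ξ hξ => ?_) hQint
      rw [hI] at hξ
      have h0 := (C.heps.trans_le hξ.1).ne'
      simpa [one_div] using (hasDerivAt_inv h0).fun_neg
    rw [h]
    have := one_div_pos.2 (C.heps.trans C.hepsom)
    linarith
  have hΓint := intervalIntegrable_linear (T := T) hx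
  have key : -(∫ ξ in C.eps..C.om, C.U x ξ * gapKernelDeriv T ξ (f T ξ) (pderivT C f T ξ)) ≤
      C.MT / (2 * σ) * Γ - C.U₁ * (C.MT * σ * (m / 2)) * J
        + C.U₂ * (2 * (Real.sqrt C.a * σ) * C.Mz ^ 2) * ∫ ξ in C.eps..C.om, 1 / ξ ^ 2 := by
    rw [← intervalIntegral.integral_neg, ← intervalIntegral.integral_const_mul,
      ← intervalIntegral.integral_const_mul, ← intervalIntegral.integral_const_mul,
      ← intervalIntegral.integral_sub (hΓint.const_mul _) (hJint.const_mul _),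
      ← intervalIntegral.integral_add ((hΓint.const_mul _).sub (hJint.const_mul _))
        (hQint.const_mul _)]
    refine intervalIntegral.integral_mono_on C.hepsom.le
      (ContinuousOn.intervalIntegrable (by
        rw [hI]
        exact (hf.continuousOn_integrand_deriv hT hx).neg))
      (((hΓint.const_mul _).sub (hJint.const_mul _)).add (hQint.const_mul _)) fun ξ hξ => ?_
    have hξ0 := C.heps.trans_le hξ.1
    have hw := hf.pos (Ioo_subset_Ico_self hT) hξ
    have hU := C.U_pos hx hξ
    have hE : C.eps ≤ Real.sqrt (ξ ^ 2 + f T ξ) :=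
      hξ.1.trans (Real.le_sqrt_of_sq_le (by linarith))
    have hmono : m ≤ tanhGap (Real.sqrt (ξ ^ 2 + f T ξ) / (2 * T)) := by
      have := C.heps
      refine tanhGap_monotoneOn (mem_Ici.2 (div_nonneg C.heps.le (by linarith [hT.2])))
        (mem_Ici.2 (by positivity)) (div_le_div₀ (Real.sqrt_nonneg _) hE (by positivity) ?_)
      linarith [hT.2]
    have h1 := neg_gapKernelDeriv_le_refined hT0 hξ0 hw hM.le (hf.2.2.2.2.2.2 T hTc ξ hξ) hσ
      (hσf ξ hξ).1 (hσf ξ hξ).2 hm0 hmono ((hf.2.1 T hTc ξ hξ).2.trans (C.Δ₂_le_zero hTc))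
      fun z hz => C.div_cosh_le hz
    have hJ0 : 0 ≤ C.MT * σ * (m / 2) * (ξ ^ 2 + C.Δ₂ 0 ^ 2) ^ (-(3 : ℝ) / 2) := by positivity
    have hQ0 : 0 ≤ 2 * (Real.sqrt C.a * σ) * C.Mz ^ 2 * (1 / ξ ^ 2) := by positivity
    have h2 := mul_le_mul_of_nonneg_left h1 hU.le
    have h3 := mul_le_mul_of_nonneg_right (C.hUlb x hx ξ hξ) hJ0
    have h4 := mul_le_mul_of_nonneg_right (C.hUub x hx ξ hξ) hQ0
    have h5 : C.MT / (2 * σ) * (C.U x ξ / ξ * Real.tanh (ξ / (2 * T))) =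
        C.U x ξ * (C.MT / (2 * σ) * (Real.tanh (ξ / (2 * T)) / ξ)) := by ring
    rw [h5]
    linarith
  have hMT := hf.MT_mul
  rw [← hm, ← hJ] at hMT
  have hsqrt : Real.sqrt C.a ≤ C.a := by
    rw [Real.sqrt_le_left (zero_le_one.trans C.one_le_a)]
    nlinarith [C.one_le_a]
  have heps := C.heps
  have h6 : C.U₂ * (2 * (Real.sqrt C.a * σ) * C.Mz ^ 2) * ∫ ξ in C.eps..C.om, 1 / ξ ^ 2 ≤
      C.U₂ * (2 * (C.a * σ) * C.Mz ^ 2) * (1 / C.eps) := by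
    have ha := zero_le_one.trans C.one_le_a
    have hQ0 : 0 ≤ ∫ ξ in C.eps..C.om, 1 / ξ ^ 2 :=
      intervalIntegral.integral_nonneg C.hepsom.le fun ξ _ => by positivity
    gcongr
  have h7 : C.U₂ * (2 * (C.a * σ) * C.Mz ^ 2) * (1 / C.eps) =
      C.U₁ * (C.MT * σ * (m / 2)) * J := by
    field_simp
    linear_combination -hMT
  linarith

lemma neg_deriv_sq_le (hf : memW C f) (hcond : gapCondition C) {T x : ℝ}
    (hT : T ∈ Ioo C.T₀ C.Tc) (hx : x ∈ C.Iset) :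
    -(2 * gapIntegral C f T x *
      ∫ ξ in C.eps..C.om, C.U x ξ * gapKernelDeriv T ξ (f T ξ) (pderivT C f T ξ)) ≤ C.MT := by
  have hTc := Ioo_subset_Icc_self hT
  obtain ⟨σ, hσ, hσf⟩ := hf.exists_sqrt_bounds (Ioo_subset_Ico_self hT)
  have h1 := hf.neg_integral_deriv_le hT hx hσ hσf
  have h2 := hf.gapIntegral_le hTc hx fun ξ hξ => (hσf ξ hξ).2
  have h3 : 0 ≤ gapIntegral C f T x := gapIntegral_nonneg hTc hx
  have h4 := hcond T hTc x hx
  have hM := hf.MT_pos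
  have ha := zero_le_one.trans C.one_le_a
  have h5 : 0 ≤ ∫ ξ in C.eps..C.om, C.U x ξ / ξ * Real.tanh (ξ / (2 * T)) :=
    intervalIntegral.integral_nonneg C.hepsom.le fun ξ hξ => by
      have h0 := C.heps.trans_le hξ.1
      have hT0 := C.T₀_pos.trans hT.1
      exact mul_nonneg (div_nonneg (C.U_pos hx hξ).le h0.le) (Real.tanh_nonneg' (by positivity))
  have hsq : (C.a ^ ((1 : ℝ) / 4)) ^ 2 = Real.sqrt C.a := by
    rw [Real.sqrt_eq_rpow, ← Real.rpow_natCast, ← Real.rpow_mul ha]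
    norm_num
  generalize (∫ ξ in C.eps..C.om, C.U x ξ / ξ * Real.tanh (ξ / (2 * T))) = Γ at *
  generalize (∫ ξ in C.eps..C.om, C.U x ξ * gapKernelDeriv T ξ (f T ξ) (pderivT C f T ξ)) = Φ' at *
  generalize gapIntegral C f T x = Φ at *
  have h6 : Real.sqrt C.a * Γ ^ 2 ≤ 1 := by
    rw [← hsq, ← mul_pow]
    exact pow_le_one₀ (by positivity) h4
  calc -(2 * Φ * Φ') = 2 * Φ * -Φ' := by ring
    _ ≤ 2 * Φ * (C.MT / (2 * σ) * Γ) := by gcongr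
    _ ≤ 2 * (Real.sqrt C.a * σ * Γ) * (C.MT / (2 * σ) * Γ) := by gcongr
    _ = C.MT * (Real.sqrt C.a * Γ ^ 2) := by field_simp
    _ ≤ C.MT := mul_le_of_le_one_right hM.le h6

end memW

lemma ClosedConstraints.congr {C : BCSContext} {φ ψ : ℝ → ℝ → ℝ} (h : ClosedConstraints C φ)
    (heq : ∀ T ∈ Icc C.T₀ C.Tc, ∀ x ∈ C.Iset, ψ T x = φ T x) : ClosedConstraints C ψ where
  nonneg T hT x hx := (heq T hT x hx).symm ▸ h.nonneg T hT x hx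
  le_sq T hT x hx := (heq T hT x hx).symm ▸ h.le_sq T hT x hx
  zero x hx := (heq _ (right_mem_Icc.2 C.hT₀₂.le) x hx).trans (h.zero x hx)
  ratio T hT x hx y hy := by
    rw [heq T hT x hx, heq T hT y hy]
    exact h.ratio T hT x hx y hy
  anti x hx := (h.anti x hx).congr fun T hT => (heq T hT x hx).symm
  lip x hx T hT T' hT' hTT' := by
    rw [heq T hT x hx, heq T' hT' x hx]
    exact h.lip x hx T hT T' hT' hTT'

namespace memW

variable {C : BCSContext} {f : ℝ → ℝ → ℝ}

lemma intervalIntegrable_integrand (hf : memW C f) {T x : ℝ} (hT : T ∈ Icc C.T₀ C.Tc)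
    (hx : x ∈ C.Iset) :
    IntervalIntegrable (fun ξ => C.U x ξ * gapKernel T ξ (f T ξ)) volume C.eps C.om := by
  refine ContinuousOn.intervalIntegrable ?_
  rw [uIcc_of_le C.hepsom.le]
  exact hf.continuousOn_integrand hT hx

lemma gapIntegral_le_delta (hf : memW C f) {T x : ℝ} (hT : T ∈ Icc C.T₀ C.Tc)
    (hx : x ∈ C.Iset) : gapIntegral C f T x ≤ C.Δ₂ T := by
  have hT0 := C.T₀_pos.trans_le hT.1
  have hcont : ContinuousOn (fun ξ => gapKernel T ξ (C.Δ₂ T ^ 2)) (Icc C.eps C.om) :=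
    continuousOn_gapKernel continuousOn_const continuousOn_id continuousOn_const (fun _ _ => hT0)
      (fun _ hξ => C.heps.trans_le hξ.1) fun _ _ => sq_nonneg _
  have h1 : gapIntegral C f T x ≤ ∫ ξ in C.eps..C.om, C.U₂ * gapKernel T ξ (C.Δ₂ T ^ 2) := by
    refine intervalIntegral.integral_mono_on C.hepsom.le (hf.intervalIntegrable_integrand hT hx)
      (ContinuousOn.intervalIntegrable (by
        rw [uIcc_of_le C.hepsom.le]
        exact continuousOn_const.mul hcont)) fun ξ hξ => ?_
    exact mul_le_mul (C.hUub x hx ξ hξ)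
      (gapKernel_mono hT0 le_rfl (C.heps.trans_le hξ.1) (hf.nonneg hT hξ) (hf.2.1 T hT ξ hξ).2)
      (gapKernel_nonneg hT0.le) (C.hU₁pos.le.trans C.hU₁₂)
  refine h1.trans_eq ?_
  simp_rw [gapKernel_eq (sq_nonneg (C.Δ₂ T)), Real.sqrt_sq (C.hΔ₂nonneg T)]
  rw [intervalIntegral.integral_const_mul, intervalIntegral.integral_const_mul, mul_left_comm,
    C.hΔ₂eq T ⟨hT0, hT.2.trans C.hTc₂⟩, mul_one]

lemma gapIntegral_ratio (hf : memW C f) {T x y : ℝ} (hT : T ∈ Icc C.T₀ C.Tc)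
    (hx : x ∈ C.Iset) (hy : y ∈ C.Iset) :
    gapIntegral C f T x ≤ C.Umax / C.Umin * gapIntegral C f T y := by
  have hT0 := C.T₀_pos.trans_le hT.1
  rw [gapIntegral, gapIntegral, ← intervalIntegral.integral_const_mul]
  refine intervalIntegral.integral_mono_on C.hepsom.le (hf.intervalIntegrable_integrand hT hx)
    ((hf.intervalIntegrable_integrand hT hy).const_mul _) fun ξ hξ => ?_
  rw [← mul_assoc]
  refine mul_le_mul_of_nonneg_right ?_ (gapKernel_nonneg hT0.le)
  rw [div_mul_eq_mul_div, le_div_iff₀ C.Umin_pos]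
  exact mul_le_mul (C.hUmax.2 ⟨x, hx, ξ, hξ, rfl⟩) (C.hUmin.2 ⟨y, hy, ξ, hξ, rfl⟩) C.Umin_pos.le
    (C.Umin_pos.le.trans C.Umin_le_Umax)

lemma gapIntegral_antitoneOn (hf : memW C f) {x : ℝ} (hx : x ∈ C.Iset) :
    AntitoneOn (fun T => gapIntegral C f T x) (Icc C.T₀ C.Tc) := fun _ hT _ hT' hTT' =>
  intervalIntegral.integral_mono_on C.hepsom.le (hf.intervalIntegrable_integrand hT' hx)
    (hf.intervalIntegrable_integrand hT hx) fun _ hξ =>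
    mul_le_mul_of_nonneg_left (gapKernel_mono (C.T₀_pos.trans_le hT.1) hTT'
      (C.heps.trans_le hξ.1) (hf.nonneg hT' hξ) ((hf.strictAntiOn hξ).antitoneOn hT hT' hTT'))
      (C.U_pos hx hξ).le

lemma closedConstraints_opA (hf : memW C f) (hcond : gapCondition C)
    (hcont : ∀ x ∈ C.Iset, ContinuousOn (fun T => opA C f T x) (Icc C.T₀ C.Tc)) :
    ClosedConstraints C (opA C f) where
  nonneg T _ x _ := sq_nonneg _
  le_sq T hT x hx := by
    rw [opA_eq_sq]
    exact pow_le_pow_left₀ (gapIntegral_nonneg hT hx) (hf.gapIntegral_le_delta hT hx) 2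
  zero x hx := by
    rw [opA_congr (g := fun _ _ => 0) hf.2.2.1]
    simp [opA]
  ratio T hT x hx y hy := by
    rw [opA_eq_sq, opA_eq_sq, C.ha, ← mul_pow]
    exact pow_le_pow_left₀ (gapIntegral_nonneg hT hx) (hf.gapIntegral_ratio hT hx hy) 2
  anti x hx T hT T' hT' hTT' := by
    simp only [opA_eq_sq]
    exact pow_le_pow_left₀ (gapIntegral_nonneg hT' hx)
      (hf.gapIntegral_antitoneOn hx hT hT' hTT') 2
  lip x hx T hT T' hT' hTT' := by
    have hd : ∀ t ∈ interior (Icc C.T₀ C.Tc), HasDerivAt (fun t => opA C f t x)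
        (2 * gapIntegral C f t x *
          ∫ ξ in C.eps..C.om, C.U x ξ * gapKernelDeriv t ξ (f t ξ) (pderivT C f t ξ)) t := by
      intro t ht
      rw [interior_Icc] at ht
      simp only [opA_eq_sq]
      exact ((hf.hasDerivAt_gapIntegral ht hx).fun_pow 2).congr_deriv (by norm_num)
    have h := (convex_Icc C.T₀ C.Tc).mul_sub_le_image_sub_of_le_deriv (hcont x hx)
      (fun t ht => (hd t ht).differentiableAt.differentiableWithinAt) (C := -C.MT)
      (fun t ht => by
        rw [(hd t ht).deriv]
        rw [interior_Icc] at ht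
        linarith [hf.neg_deriv_sq_le hcond ht hx]) T hT T' hT' hTT'
    linarith

end memW

section Extension

variable {C : BCSContext}

lemma nonneg_of_mem_closure {F : C(↥C.Dset, ℝ)} (hF : F ∈ closure (WSet C)) (p : ↥C.Dset) :
    0 ≤ F p := by
  have hclosed : IsClosed {G : C(↥C.Dset, ℝ) | 0 ≤ G p} :=
    isClosed_le continuous_const (continuous_eval_const p)
  refine closure_minimal ?_ hclosed hF
  rintro G ⟨f, hf, hGf⟩
  exact (hf.nonneg p.2.1 p.2.2).trans_eq (hGf p).symm

lemma opAMap_mem_closure (hcond : gapCondition C) {F : C(↥C.Dset, ℝ)} (hF : F ∈ WSet C) :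
    opAMap C F ∈ closure (WSet C) := by
  have hF0 := nonneg_of_mem_closure (subset_closure hF)
  obtain ⟨f, hf, hFf⟩ := hF
  have heq : ∀ T ∈ Icc C.T₀ C.Tc, ∀ x ∈ C.Iset, extFun C (opAMap C F) T x = opA C f T x := by
    intro T hT x hx
    rw [← opA_eq_opAMap hF0 ⟨hT, hx⟩]
    refine opA_congr (fun ξ hξ => ?_) x
    rw [extFun_apply C F ⟨hT, hξ⟩]
    exact hFf _
  have hcont : ∀ x ∈ C.Iset, ContinuousOn (fun T => opA C f T x) (Icc C.T₀ C.Tc) := fun x hx =>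
    ((continuousOn_extFun C (opAMap C F)).comp (f := fun T : ℝ => (T, x)) (by fun_prop)
      fun T hT => ⟨hT, hx⟩).congr fun T hT => (heq T hT x hx).symm
  obtain ⟨c, hc, hcM, hcΔ⟩ := hf.exists_linear_le_sq
  exact mem_closure_WSet C ((hf.closedConstraints_opA hcond hcont).congr heq) hc hcM hcΔ

end Extension

theorem stmt_15 (C : BCSContext) (hcond : gapCondition C) :
    ∀ F ∈ closure (WSet C), ∃ G ∈ closure (WSet C),
      ∀ g : ℕ → C(↥C.Dset, ℝ), (∀ n, g n ∈ WSet C) → Tendsto g atTop (𝓝 F) →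
        UniformCauchySeqOn (fun n (p : ℝ × ℝ) => opA C (extFun C (g n)) p.1 p.2)
          atTop C.Dset ∧
        TendstoUniformlyOn (fun n (p : ℝ × ℝ) => opA C (extFun C (g n)) p.1 p.2)
          (fun p : ℝ × ℝ => extFun C G p.1 p.2) atTop C.Dset := by
  intro F hF
  have hmaps : MapsTo (opAMap C) (WSet C) (closure (WSet C)) := fun _ => opAMap_mem_closure hcond
  refine ⟨opAMap C F, ?_, fun g hg hgF => ?_⟩
  · simpa only [closure_closure] using hmaps.closure (opAMap C).continuous hF
  have hlim := ((opAMap C).continuous.tendsto F).comp hgF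
  have hunif : TendstoUniformlyOn (fun n (p : ℝ × ℝ) => opA C (extFun C (g n)) p.1 p.2)
      (fun p : ℝ × ℝ => extFun C (opAMap C F) p.1 p.2) atTop C.Dset := by
    rw [Metric.tendstoUniformlyOn_iff]
    intro ε hε
    filter_upwards [(Metric.tendsto_nhds.1 hlim) ε hε] with n hn p hp
    rw [opA_eq_opAMap (nonneg_of_mem_closure (subset_closure (hg n))) hp,
      extFun_apply C _ hp, extFun_apply C _ hp, dist_comm]
    exact (ContinuousMap.dist_apply_le_dist _).trans_lt hn
  exact ⟨hunif.uniformCauchySeqOn, hunif⟩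

end
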